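/- Let k be a field, A a commutative k-algebra, m ≥ 3 an integer, n ≥ 0, and d₁,…,dₙ positive integers. Let φ be the k-algebra homomorphism from B = A[z₁^{±1},…,zₙ^{±1}, t₁,…,tₙ] to C = A ⊗_k k(w₁,…,wₙ)[t₁^{±1},…,tₙ^{±1}] that is the identity on A, sends t_i ↦ t_i, and sends z_i ↦ w_i·t_i^{d_i} for 1 ≤ i ≤ n (where k(w₁,…,wₙ) is the rational function field in n variables over k). If g ∈ SL_m(B) is such that φ(g) ∈ E_m(C), then g ∈ E_m(B). Equivalently, the induced map K1^{SL_m}(B) → K1^{SL_m}(C) is injective. -/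

import Mathlib

open Matrix
open scoped TensorProduct

/-- The elementary subgroup `E_m(S)` of `SL_m(S)`. -/
def ElemSubgroup (m : ℕ) (S : Type*) [CommRing S] :
    Subgroup (SpecialLinearGroup (Fin m) S) :=
  Subgroup.closure { g | ∃ i j : Fin m, ∃ a : S, i ≠ j ∧
    (g : Matrix (Fin m) (Fin m) S) = Matrix.transvection i j a }

namespace SLElem

/-- `SL_m(S)`. -/
abbrev SL (m : ℕ) (S : Type*) [CommRing S] := Matrix.SpecialLinearGroup (Fin m) S

/-- The homomorphism of special linear groups induced by a ring homomorphism. -/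
abbrev mp {m : ℕ} {S S' : Type*} [CommRing S] [CommRing S'] (f : S →+* S') : SL m S →* SL m S' :=
  Matrix.SpecialLinearGroup.map f

lemma conj_mem_of_closure {G : Type*} [Group G] {T : Set G} {Q : Subgroup G} {x : G}
    (h : ∀ g ∈ T, x * g * x⁻¹ ∈ Q) {g : G} (hg : g ∈ Subgroup.closure T) : x * g * x⁻¹ ∈ Q := by
  have : Subgroup.closure T ≤ Q.comap (MulAut.conj x).toMonoidHom :=
    (Subgroup.closure_le _).2 h
  exact this hg

section Basic

variable {m : ℕ} {S S' : Type*} [CommRing S] [CommRing S']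

lemma ext_val {g g' : SL m S}
    (h : (g : Matrix (Fin m) (Fin m) S) = g') : g = g' := Subtype.ext h

/-- The elementary matrix `e_{ij}(a)` as an element of `SL_m(S)`. -/
def el (i j : Fin m) (h : i ≠ j) (a : S) : SL m S :=
  ⟨transvection i j a, det_transvection_of_ne i j h a⟩

lemma coe_el (i j : Fin m) (h : i ≠ j) (a : S) :
    (el i j h a : Matrix (Fin m) (Fin m) S) = 1 + Matrix.single i j a := rfl

lemma el_apply (i j : Fin m) (h : i ≠ j) (a : S) (p q : Fin m) :
    (el i j h a).1 p q = (if p = q then 1 else 0) + if i = p ∧ j = q then a else 0 := by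
  change (1 + Matrix.single i j a : Matrix (Fin m) (Fin m) S) p q = _
  simp [Matrix.add_apply, Matrix.one_apply, Matrix.single_apply]

lemma elemSubgroup_eq_closure :
    ElemSubgroup m S = Subgroup.closure {g | ∃ i j, ∃ h : i ≠ j, ∃ a, g = el i j h a} := by
  unfold ElemSubgroup
  congr 1
  ext g
  constructor
  · rintro ⟨i, j, a, h, e⟩
    exact ⟨i, j, h, a, Subtype.ext e⟩
  · rintro ⟨i, j, h, a, rfl⟩
    exact ⟨i, j, a, h, rfl⟩

lemma el_mem (i j : Fin m) (h : i ≠ j) (a : S) : el i j h a ∈ ElemSubgroup m S :=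
  Subgroup.subset_closure ⟨i, j, a, h, rfl⟩

lemma el_add (i j : Fin m) (h : i ≠ j) (a b : S) : el i j h (a + b) = el i j h a * el i j h b :=
  Subtype.ext (transvection_mul_transvection_same i j h a b).symm

lemma el_zero (i j : Fin m) (h : i ≠ j) : el i j h (0 : S) = 1 :=
  Subtype.ext (transvection_zero i j)

lemma el_neg (i j : Fin m) (h : i ≠ j) (a : S) : el i j h (-a) = (el i j h a)⁻¹ := by
  rw [eq_inv_iff_mul_eq_one, ← el_add, neg_add_cancel, el_zero]

lemma map_el (f : S →+* S') (i j : Fin m) (h : i ≠ j) (a : S) :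
    mp f (el i j h a) = el i j h (f a) := by
  ext p q
  simp only [Matrix.SpecialLinearGroup.map_apply_coe, RingHom.mapMatrix_apply, Matrix.map_apply, el_apply]
  split_ifs <;> simp

/-- To prove a statement for all of `E_m(S)` it is enough to treat products with generators. -/
lemma elem_induction {p : SL m S → Prop} (one : p 1)
    (mul : ∀ x y, p x → p y → p (x * y)) (gen : ∀ i j h a, p (el i j h a))
    {g : SL m S} (hg : g ∈ ElemSubgroup m S) : p g := by
  have h2 : p g ∧ p g⁻¹ := by
    rw [elemSubgroup_eq_closure] at hg
    induction hg using Subgroup.closure_induction with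
    | mem x hx =>
      obtain ⟨i, j, h, a, rfl⟩ := hx
      exact ⟨gen _ _ _ _, by rw [← el_neg]; exact gen _ _ _ _⟩
    | one => simpa using one
    | mul x y _ _ hx hy => exact ⟨mul _ _ hx.1 hy.1, by rw [_root_.mul_inv_rev]; exact mul _ _ hy.2 hx.2⟩
    | inv x _ hx => exact ⟨hx.2, by simpa using hx.1⟩
  exact h2.1

lemma elem_le {Q : Subgroup (SL m S)} (h : ∀ i j h a, el i j h a ∈ Q) :
    ElemSubgroup m S ≤ Q :=
  fun _ hg => elem_induction Q.one_mem (fun _ _ => Q.mul_mem) h hg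

lemma map_mem (f : S →+* S') {g : SL m S} (hg : g ∈ ElemSubgroup m S) :
    mp f g ∈ ElemSubgroup m S' :=
  elem_le (Q := (ElemSubgroup m S').comap (mp f))
    (fun i j h a => by rw [Subgroup.mem_comap, map_el]; exact el_mem _ _ _ _) hg

lemma map_map {S'' : Type*} [CommRing S''] (f : S →+* S') (f' : S' →+* S'')
    (g : SL m S) :
    mp f' (mp f g)
      = mp (f'.comp f) g := by
  ext; rfl

lemma map_id (g : SL m S) :
    mp (RingHom.id S) g = g := by
  ext; rfl

lemma map_injective {f : S →+* S'} (hf : Function.Injective f) :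
    Function.Injective (mp (m := m) f) := by
  intro g g' h
  ext i j
  apply hf
  exact congrArg (fun x : SL m S' => x.1 i j) h

lemma conj_of_ne {i j k l : Fin m} (h : i ≠ j) (h' : k ≠ l) (hli : l ≠ i) (hkj : j ≠ k) (r a : S) :
    el k l h' r * el i j h a * el k l h' (-r) = el i j h a := by
  refine ext_val ?_
  simp only [Matrix.SpecialLinearGroup.coe_mul, coe_el, mul_add, add_mul, one_mul, mul_one]
  rw [Matrix.single_mul_single_of_ne (h := hli), Matrix.single_mul_single_of_ne (h := hkj),
    Matrix.single_mul_single_of_ne (h := h'.symm), ← neg_add_cancel (Matrix.single k l r),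
    ← Matrix.single_neg]
  simp
  abel

lemma conj_left {i j k : Fin m} (h : i ≠ j) (h' : k ≠ i) (hkj : k ≠ j) (r a : S) :
    el k i h' r * el i j h a * el k i h' (-r) = el i j h a * el k j hkj (r * a) := by
  refine ext_val ?_
  simp only [Matrix.SpecialLinearGroup.coe_mul, coe_el, mul_add, add_mul, one_mul, mul_one]
  simp only [Matrix.single_mul_single_same, ne_eq, h'.symm, hkj.symm, not_false_eq_true,
    Matrix.single_mul_single_of_ne, add_zero]
  rw [← Matrix.single_neg]
  abel

lemma conj_right {i j l : Fin m} (h : i ≠ j) (h' : j ≠ l) (hil : i ≠ l) (r a : S) :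
    el j l h' r * el i j h a * el j l h' (-r) = el i j h a * el i l hil (-(a * r)) := by
  refine ext_val ?_
  simp only [Matrix.SpecialLinearGroup.coe_mul, coe_el, mul_add, add_mul, one_mul, mul_one]
  simp only [Matrix.single_mul_single_same, ne_eq, h.symm, h'.symm, hil.symm, not_false_eq_true,
    Matrix.single_mul_single_of_ne, zero_mul, add_zero]
  rw [← Matrix.single_neg, mul_neg, ← Matrix.single_neg]
  abel

lemma el_mul_eq_commutator {i j p : Fin m} (h : i ≠ j) (h1 : i ≠ p) (h2 : p ≠ j) (a b : S) :
    el i j h (a * b) = el i p h1 a * el p j h2 b * el i p h1 (-a) * el p j h2 (-b) := by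
  rw [conj_left h2 h1 h, el_neg p j]
  have h3 := conj_of_ne h h2 h.symm h2.symm b (a * b)
  rw [el_neg] at h3
  exact h3.symm

/-- Transpose inverse, as an endomorphism of `SL_m(S)`. -/
def invT : SL m S →* SL m S where
  toFun g := (g.transpose)⁻¹
  map_one' := by ext; simp
  map_mul' x y := by
    rw [← _root_.mul_inv_rev]; congr 1; refine ext_val ?_; simp [Matrix.SpecialLinearGroup.coe_transpose]

lemma invT_invT (g : SL m S) : invT (invT g) = g := by
  have : ∀ x : SL m S, (x⁻¹).transpose = x.transpose⁻¹ := fun x => by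
    rw [eq_inv_iff_mul_eq_one]
    refine ext_val ?_
    rw [Matrix.SpecialLinearGroup.coe_mul, Matrix.SpecialLinearGroup.coe_transpose,
      Matrix.SpecialLinearGroup.coe_transpose, ← Matrix.transpose_mul, ← Matrix.SpecialLinearGroup.coe_mul]
    simp
  change ((g.transpose)⁻¹.transpose)⁻¹ = g
  rw [this, inv_inv]
  refine ext_val ?_; simp

lemma invT_el (i j : Fin m) (h : i ≠ j) (a : S) : invT (el i j h a) = el j i h.symm (-a) := by
  rw [el_neg]
  change _⁻¹ = _⁻¹
  congr 1
  refine ext_val ?_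
  simp [coe_el, Matrix.SpecialLinearGroup.coe_transpose]

lemma map_invT (f : S →+* S') (g : SL m S) :
    mp f (invT g) = invT (mp f g) := by
  change mp f (g.transpose)⁻¹ = (mp f g).transpose⁻¹
  rw [map_inv]
  rfl

/-- The unipotent matrix whose `k`-th column is `c` off the diagonal. -/
def colSL (k : Fin m) (c : Fin m → S) : SL m S :=
  ⟨1 + Matrix.vecMulVec (Function.update c k 0) (Pi.single k 1), by
    rw [Matrix.vecMulVec_eq Unit, Matrix.det_one_add_replicateCol_mul_replicateRow]; simp⟩

lemma coe_colSL (k : Fin m) (c : Fin m → S) (i j : Fin m) :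
    (colSL k c).1 i j = (if i = j then 1 else 0) + if j = k ∧ i ≠ k then c i else 0 := by
  simp only [colSL, Matrix.add_apply, Matrix.one_apply, Matrix.vecMulVec_apply,
    Function.update_apply, Pi.single_apply]
  grind

lemma val_colSL (k : Fin m) (c : Fin m → S) : (colSL k c : Matrix (Fin m) (Fin m) S) =
    1 + Matrix.vecMulVec (Function.update c k 0) (Pi.single k 1) := rfl

lemma colSL_add (k : Fin m) (c d : Fin m → S) : colSL k (c + d) = colSL k c * colSL k d := by
  refine ext_val ?_
  simp only [Matrix.SpecialLinearGroup.coe_mul, val_colSL, mul_add, add_mul, one_mul, mul_one,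
    Matrix.vecMulVec_mul_vecMulVec]
  have : Function.update (c + d) k 0 = Function.update c k 0 + Function.update d k 0 := by
    ext i; by_cases h : i = k <;> simp [h]
  rw [this, Matrix.add_vecMulVec]
  simp [add_assoc]

lemma colSL_zero (k : Fin m) : colSL k (0 : Fin m → S) = 1 := by
  ext i j
  simp [coe_colSL, Matrix.one_apply]

lemma colSL_neg (k : Fin m) (c : Fin m → S) : colSL k (-c) = (colSL k c)⁻¹ := by
  rw [eq_inv_iff_mul_eq_one, ← colSL_add, neg_add_cancel, colSL_zero]

lemma colSL_single (k i : Fin m) (h : i ≠ k) (a : S) : colSL k (Pi.single i a) = el i k h a := by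
  ext p q
  rw [coe_colSL, el_apply]
  by_cases hp : p = i
  · subst hp; simp [h, eq_comm]
  · simp [hp, Ne.symm hp]

lemma colSL_single_self (k : Fin m) (a : S) : colSL k (Pi.single k a) = 1 := by
  ext p q
  rw [coe_colSL]
  by_cases hp : p = k
  · subst hp; simp [Matrix.one_apply]
  · simp [hp, Matrix.one_apply]

lemma colSL_mem {Q : Subgroup (SL m S)} (k : Fin m) (c : Fin m → S)
    (h : ∀ i (hi : i ≠ k), el i k hi (c i) ∈ Q) : colSL k c ∈ Q := by
  have key : ∀ s : Finset (Fin m), colSL k (∑ i ∈ s, Pi.single i (c i)) ∈ Q := by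
    intro s
    induction s using Finset.induction_on with
    | empty => simp [colSL_zero, Q.one_mem]
    | insert a s ha ih =>
      rw [Finset.sum_insert ha, colSL_add]
      refine Q.mul_mem ?_ ih
      by_cases hk : a = k
      · subst hk; rw [colSL_single_self]; exact Q.one_mem
      · rw [colSL_single k a hk]; exact h a hk
  have := key Finset.univ
  rwa [Finset.univ_sum_single] at this

lemma map_colSL (f : S →+* S') (k : Fin m) (c : Fin m → S) :
    mp f (colSL k c) = colSL k (fun i => f (c i)) := by
  ext p q
  simp only [Matrix.SpecialLinearGroup.map_apply_coe, RingHom.mapMatrix_apply, Matrix.map_apply, coe_colSL]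
  split_ifs <;> simp

/-- The unipotent matrix whose `k`-th row is `c` off the diagonal. -/
def rowSL (k : Fin m) (c : Fin m → S) : SL m S :=
  (colSL k c).transpose

lemma coe_rowSL (k : Fin m) (c : Fin m → S) (i j : Fin m) :
    (rowSL k c).1 i j = (if i = j then 1 else 0) + if i = k ∧ j ≠ k then c j else 0 := by
  change (colSL k c).1 j i = _
  simp [coe_colSL, eq_comm]

lemma rowSL_eq_invT (k : Fin m) (c : Fin m → S) : rowSL k c = invT (colSL k (-c)) := by
  rw [colSL_neg, map_inv]
  change _ = ((_ : SL m S)⁻¹)⁻¹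
  rw [inv_inv]; rfl

lemma rowSL_mem {Q : Subgroup (SL m S)} (k : Fin m) (c : Fin m → S)
    (h : ∀ i (hi : i ≠ k), el k i hi.symm (c i) ∈ Q) : rowSL k c ∈ Q := by
  rw [rowSL_eq_invT]
  refine colSL_mem (Q := Q.comap invT) k (-c) fun i hi => ?_
  rw [Subgroup.mem_comap, invT_el]
  simpa using h i hi

lemma map_rowSL (f : S →+* S') (k : Fin m) (c : Fin m → S) :
    mp f (rowSL k c) = rowSL k (fun i => f (c i)) := by
  ext p q
  simp only [Matrix.SpecialLinearGroup.map_apply_coe, RingHom.mapMatrix_apply, Matrix.map_apply, coe_rowSL]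
  split_ifs <;> simp

lemma exists_ne_ne (hm : 3 ≤ m) (i j : Fin m) : ∃ p, p ≠ i ∧ p ≠ j := by
  have : ({i, j} : Finset (Fin m)).card < Fintype.card (Fin m) := by
    rw [Fintype.card_fin]; exact lt_of_le_of_lt Finset.card_le_two hm
  obtain ⟨p, hp⟩ := Finset.exists_mem_notMem_of_card_lt_card (t := Finset.univ) this
  exact ⟨p, by simpa [not_or] using hp⟩

end Basic

section Conjugation

variable {m : ℕ} {S S' : Type*} [CommRing S] [CommRing S']

/-- The subgroup generated by the images of the elementary matrices with entry divisible by `s`. -/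
def smallE (m : ℕ) (f : S →+* S') (s : S) : Subgroup (SL m S') :=
  Subgroup.closure {g | ∃ i j, ∃ h : i ≠ j, ∃ c, g = el i j h (f (s * c))}

lemma el_mem_smallE (f : S →+* S') (s : S) (i j : Fin m) (h : i ≠ j) (c : S) :
    el i j h (f (s * c)) ∈ smallE m f s :=
  Subgroup.subset_closure ⟨i, j, h, c, rfl⟩

lemma smallE_le_map (f : S →+* S') (s : S) : smallE m f s ≤ (ElemSubgroup m S).map (mp f) := by
  refine (Subgroup.closure_le _).2 ?_
  rintro _ ⟨i, j, h, c, rfl⟩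
  exact ⟨el i j h (s * c), el_mem _ _ _ _, map_el _ _ _ _ _⟩

/-- `S'` is a localization of `S` at `M` along `f` (with `M` possibly not acting by units). -/
structure IsLoc (f : S →+* S') (M : Submonoid S) : Prop where
  surj : ∀ r, ∃ s ∈ M, ∃ c, f c = f s * r
  ker : ∀ a, f a = 0 → ∃ s ∈ M, s * a = 0

lemma conj_small_gen (hm : 3 ≤ m) {f : S →+* S'} {M : Submonoid S}
    (hM : ∀ r, ∃ s ∈ M, ∃ c, f c = f s * r) (k l : Fin m) (hkl : k ≠ l) (r : S') :
    ∀ s' ∈ M, ∃ s ∈ M, ∀ i j (h : i ≠ j) c,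
      el k l hkl r * el i j h (f (s * c)) * (el k l hkl r)⁻¹ ∈ smallE m f s' := by
  intro s' hs'
  obtain ⟨s₂, hs₂, c₂, hc₂⟩ := hM r
  have hσ : s₂ * s' ∈ M := M.mul_mem hs₂ hs'
  have mem : ∀ i j (h : i ≠ j) (x : S'), (∃ c, x = f (s' * c)) → el i j h x ∈ smallE m f s' := by
    rintro i j h _ ⟨c, rfl⟩
    exact el_mem_smallE f s' i j h c
  refine ⟨(s₂ * s') * (s₂ * s'), M.mul_mem hσ hσ, fun i j h c => ?_⟩
  rw [← el_neg]
  have h0 : el i j h (f (s₂ * s' * (s₂ * s') * c)) ∈ smallE m f s' :=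
    mem _ _ _ _ ⟨s₂ * (s₂ * s') * c, by ring_nf⟩
  by_cases hli : l = i
  · subst hli
    by_cases hjk : j = k
    · subst hjk
      obtain ⟨p, hpj, hpl⟩ := exists_ne_ne hm j l
      have e1 : f (s₂ * s' * (s₂ * s') * c) = f (s₂ * s') * f (s₂ * s' * c) := by
        rw [← map_mul]; ring_nf
      rw [e1, el_mul_eq_commutator h hpl.symm hpj]
      have c1 : ∀ x, el j l hkl r * el l p hpl.symm (f (s₂ * s') * x) * el j l hkl (-r) =
          el l p hpl.symm (f (s₂ * s') * x) * el j p hpj.symm (r * (f (s₂ * s') * x)) :=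
        fun x => conj_left hpl.symm hkl hpj.symm r _
      have c2 : ∀ x, el j l hkl r * el p j hpj (f (s₂ * s') * x) * el j l hkl (-r) =
          el p j hpj (f (s₂ * s') * x) * el p l hpl (-(f (s₂ * s') * x * r)) :=
        fun x => conj_right hpj hkl hpl r _
      have m1 : ∀ x : S, el j l hkl r * el l p hpl.symm (f (s₂ * s') * f x) * el j l hkl (-r) ∈
          smallE m f s' := fun x => by
        rw [c1]
        refine mul_mem (mem _ _ _ _ ⟨s₂ * x, ?_⟩) (mem _ _ _ _ ⟨c₂ * x, ?_⟩)
        · simp only [map_mul]; ring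
        · simp only [map_mul, hc₂]; ring
      have m2 : ∀ x : S, el j l hkl r * el p j hpj (f (s₂ * s') * f x) * el j l hkl (-r) ∈
          smallE m f s' := fun x => by
        rw [c2]
        refine mul_mem (mem _ _ _ _ ⟨s₂ * x, ?_⟩) (mem _ _ _ _ ⟨-(c₂ * x), ?_⟩)
        · simp only [map_mul]; ring
        · simp only [map_mul, map_neg, hc₂]; ring
      have key := mul_mem (mul_mem (mul_mem (m1 1) (m2 c)) (m1 (-1))) (m2 (-c))
      convert key using 1
      have hinv : el j l hkl (-r) * el j l hkl r = 1 := by rw [← el_add, neg_add_cancel, el_zero]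
      simp only [map_one, map_neg, mul_one, mul_neg, map_mul]
      have hc : ∀ x : SL m S', el j l hkl (-r) * (el j l hkl r * x) = x := fun x => by
        rw [← mul_assoc, hinv, one_mul]
      simp only [mul_assoc, hc]
    · have hkj : k ≠ j := fun e => hjk e.symm
      rw [conj_left h hkl hkj]
      refine mul_mem h0 (mem _ _ _ _ ⟨c₂ * (s₂ * s') * c, ?_⟩)
      simp only [map_mul, hc₂]; ring
  · by_cases hjk : j = k
    · subst hjk
      have hil : i ≠ l := fun e => hli e.symm
      rw [conj_right h hkl hil]
      refine mul_mem h0 (mem _ _ _ _ ⟨-(c₂ * (s₂ * s') * c), ?_⟩)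
      simp only [map_mul, map_neg, hc₂]; ring
    · rw [conj_of_ne h hkl hli hjk]
      exact h0

lemma conj_small (hm : 3 ≤ m) {f : S →+* S'} {M : Submonoid S}
    (hM : ∀ r, ∃ s ∈ M, ∃ c, f c = f s * r) {y : SL m S'} (hy : y ∈ ElemSubgroup m S') :
    ∀ s' ∈ M, ∃ s ∈ M, ∀ i j (h : i ≠ j) c,
      y * el i j h (f (s * c)) * y⁻¹ ∈ smallE m f s' := by
  refine elem_induction (p := fun y => ∀ s' ∈ M, ∃ s ∈ M, ∀ i j (h : i ≠ j) c,
      y * el i j h (f (s * c)) * y⁻¹ ∈ smallE m f s') ?_ ?_ ?_ hy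
  · intro s' hs'
    exact ⟨s', hs', fun i j h c => by simpa using el_mem_smallE f s' i j h c⟩
  · intro x y hx hy s' hs'
    obtain ⟨s₁, hs₁, h₁⟩ := hx s' hs'
    obtain ⟨s₂, hs₂, h₂⟩ := hy s₁ hs₁
    refine ⟨s₂, hs₂, fun i j h c => ?_⟩
    have h₃ : x * (y * el i j h (f (s₂ * c)) * y⁻¹) * x⁻¹ ∈ smallE m f s' := by
      refine conj_mem_of_closure ?_ (h₂ i j h c)
      rintro _ ⟨i, j, h, c, rfl⟩
      exact h₁ i j h c
    convert h₃ using 1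
    simp [mul_assoc]
  · exact fun k l h r => conj_small_gen hm hM k l h r

lemma conj_small_map (hm : 3 ≤ m) {f : S →+* S'} {M : Submonoid S}
    (hM : ∀ r, ∃ s ∈ M, ∃ c, f c = f s * r) {y : SL m S'} (hy : y ∈ ElemSubgroup m S') :
    ∃ s ∈ M, ∀ i j (h : i ≠ j) c,
      y * el i j h (f (s * c)) * y⁻¹ ∈ (ElemSubgroup m S).map (mp f) := by
  obtain ⟨s, hs, h⟩ := conj_small hm hM hy 1 M.one_mem
  exact ⟨s, hs, fun i j hij c => smallE_le_map _ _ (h i j hij c)⟩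

end Conjugation

section Loc

variable {S S' : Type*} [CommRing S] [CommRing S'] {f : S →+* S'} {M : Submonoid S}

lemma IsLoc.ker_finset (hf : IsLoc f M) (T : Finset S) (hT : ∀ a ∈ T, f a = 0) :
    ∃ s ∈ M, ∀ a ∈ T, s * a = 0 := by
  classical
  induction T using Finset.induction_on with
  | empty => exact ⟨1, M.one_mem, by simp⟩
  | insert a T _ ih =>
    obtain ⟨s, hs, h⟩ := ih fun b hb => hT b (Finset.mem_insert_of_mem hb)
    obtain ⟨s', hs', h'⟩ := hf.ker a (hT a (Finset.mem_insert_self _ _))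
    refine ⟨s * s', M.mul_mem hs hs', fun b hb => ?_⟩
    rcases Finset.mem_insert.1 hb with rfl | hb
    · rw [mul_assoc, h', mul_zero]
    · rw [mul_comm s, mul_assoc, h b hb, mul_zero]

lemma IsLoc.poly (hf : IsLoc f M) :
    IsLoc (Polynomial.mapRingHom f) (M.map (Polynomial.C : S →+* Polynomial S)) where
  surj r := by
    induction r using Polynomial.induction_on' with
    | add p q hp hq =>
      obtain ⟨s, hs, c, hc⟩ := hp
      obtain ⟨s', hs', c', hc'⟩ := hq
      refine ⟨s * s', mul_mem hs hs', c * s' + c' * s, ?_⟩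
      rw [map_add, map_mul, map_mul, hc, hc', map_mul]; ring
    | monomial n a =>
      obtain ⟨s, hs, c, hc⟩ := hf.surj a
      refine ⟨Polynomial.C s, ⟨s, hs, rfl⟩, Polynomial.monomial n c, ?_⟩
      simp [hc, Polynomial.C_mul_monomial]
  ker p hp := by
    obtain ⟨s, hs, h⟩ := hf.ker_finset p.coeffs fun a ha => by
      obtain ⟨n, _, rfl⟩ := Polynomial.mem_coeffs_iff.1 ha
      rw [← Polynomial.coeff_map]
      have := congrArg (fun q : Polynomial S' => q.coeff n) hp
      simpa using this
    refine ⟨Polynomial.C s, ⟨s, hs, rfl⟩, ?_⟩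
    ext n
    rw [Polynomial.coeff_C_mul, Polynomial.coeff_zero]
    by_cases hn : p.coeff n = 0
    · rw [hn, mul_zero]
    · exact h _ (Polynomial.coeff_mem_coeffs hn)

lemma IsLoc.of_isLocalization [Algebra S S'] (M : Submonoid S) [IsLocalization M S'] :
    IsLoc (algebraMap S S') M where
  surj r := by
    obtain ⟨⟨c, s⟩, h⟩ := IsLocalization.surj M r
    exact ⟨s, s.2, c, by rw [← h, mul_comm]⟩
  ker a ha := by
    obtain ⟨s, hs⟩ := (IsLocalization.map_eq_zero_iff M S' a).1 ha
    exact ⟨s, s.2, hs⟩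

end Loc

section PolynomialKernel

open Polynomial

variable {m : ℕ} {A : Type*} [CommRing A]

lemma mp_apply {S S' : Type*} [CommRing S] [CommRing S'] (f : S →+* S') (g : SL m S)
    (i j : Fin m) : (mp f g).1 i j = f (g.1 i j) := rfl

lemma mp_congr {S S' : Type*} [CommRing S] [CommRing S'] {f f' : S →+* S'} (h : f = f')
    (g : SL m S) : mp f g = mp f' g := by rw [h]

/-- Evaluation at `0`. -/
noncomputable abbrev ev0 (A : Type*) [CommRing A] : A[X] →+* A := evalRingHom 0

lemma mp_ev0_C (g : SL m A) : mp (ev0 A) (mp C g) = g := by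
  rw [map_map]
  convert map_id g
  ext; simp

/-- The subgroup generated by the conjugates of the `e_{ij}(X p)` by constant elementary
matrices. -/
noncomputable def kerE (m : ℕ) (A : Type*) [CommRing A] : Subgroup (SL m A[X]) :=
  Subgroup.closure {g | ∃ y ∈ ElemSubgroup m A, ∃ i j, ∃ h : i ≠ j, ∃ p,
    g = mp C y * el i j h (X * p) * (mp C y)⁻¹}

lemma kerE_conj {y : SL m A} (hy : y ∈ ElemSubgroup m A) {g : SL m A[X]} (hg : g ∈ kerE m A) :
    mp C y * g * (mp C y)⁻¹ ∈ kerE m A := by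
  refine conj_mem_of_closure ?_ hg
  rintro _ ⟨z, hz, i, j, h, p, rfl⟩
  refine Subgroup.subset_closure ⟨y * z, mul_mem hy hz, i, j, h, p, ?_⟩
  rw [map_mul]
  group

lemma mem_kerE {g : SL m A[X]} (hg : g ∈ ElemSubgroup m A[X]) (h0 : mp (ev0 A) g = 1) :
    g ∈ kerE m A := by
  suffices h : mp (ev0 A) g ∈ ElemSubgroup m A ∧ g * (mp C (mp (ev0 A) g))⁻¹ ∈ kerE m A by
    simpa [h0] using h.2
  refine elem_induction (p := fun g => mp (ev0 A) g ∈ ElemSubgroup m A ∧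
    g * (mp C (mp (ev0 A) g))⁻¹ ∈ kerE m A) ?_ ?_ ?_ hg
  · simp [one_mem]
  · rintro x y ⟨hx, hx'⟩ ⟨hy, hy'⟩
    refine ⟨by rw [map_mul]; exact mul_mem hx hy, ?_⟩
    have := mul_mem hx' (kerE_conj hx hy')
    convert this using 1
    simp [mul_assoc]
  · intro i j h a
    refine ⟨map_mem _ (el_mem _ _ _ _), ?_⟩
    rw [map_el, map_el, ← el_neg, ← el_add]
    refine Subgroup.subset_closure ⟨1, one_mem _, i, j, h, a.divX, ?_⟩
    have : a + -C ((ev0 A) a) = X * a.divX := by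
      have := divX_mul_X_add a
      rw [coe_evalRingHom, ← coeff_zero_eq_eval_zero]
      linear_combination -this
    rw [this]; simp

/-- The substitution `X ↦ s X`. -/
noncomputable def sc (s : A) : A[X] →+* A[X] := compRingHom (C s * X)

lemma sc_X (s : A) : sc s X = C s * X := by simp [sc]

lemma sc_C (s a : A) : sc s (C a) = C a := by simp [sc]

lemma sc_coeff (s : A) (p : A[X]) (n : ℕ) : (sc s p).coeff n = p.coeff n * s ^ n :=
  comp_C_mul_X_coeff

lemma sc_sc (s t : A) (p : A[X]) : sc s (sc t p) = sc (s * t) p := by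
  ext n; simp only [sc_coeff]; ring

lemma mp_sc_sc (s t : A) (g : SL m A[X]) : mp (sc s) (mp (sc t) g) = mp (sc (s * t)) g := by
  rw [map_map]; exact mp_congr (RingHom.ext (sc_sc s t)) g

lemma map_sc {B : Type*} [CommRing B] (f : A →+* B) (s : A) (p : A[X]) :
    mapRingHom f (sc s p) = sc (f s) (mapRingHom f p) := by
  ext n; simp [sc_coeff]

lemma mp_map_sc {B : Type*} [CommRing B] (f : A →+* B) (s : A) (g : SL m A[X]) :
    mp (mapRingHom f) (mp (sc s) g) = mp (sc (f s)) (mp (mapRingHom f) g) := by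
  rw [map_map, map_map]; exact mp_congr (RingHom.ext (map_sc f s)) g

lemma mp_map_C {B : Type*} [CommRing B] (f : A →+* B) (g : SL m A) :
    mp (mapRingHom f) (mp C g) = mp C (mp f g) := by
  rw [map_map, map_map]; exact mp_congr (RingHom.ext fun a => by simp) g

lemma mp_map_ev0 {B : Type*} [CommRing B] (f : A →+* B) (g : SL m A[X]) :
    mp (ev0 B) (mp (mapRingHom f) g) = mp f (mp (ev0 A) g) := by
  rw [map_map, map_map]
  refine mp_congr (RingHom.ext fun p => ?_) g
  simp [← coeff_zero_eq_eval_zero]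

lemma mp_ev0_sc (s : A) (g : SL m A[X]) : mp (ev0 A) (mp (sc s) g) = mp (ev0 A) g := by
  rw [map_map]
  refine mp_congr (RingHom.ext fun p => ?_) g
  simp [← coeff_zero_eq_eval_zero, sc_coeff]

variable {S S' : Type*} [CommRing S] [CommRing S'] {f : S →+* S'} {M : Submonoid S}

lemma dilation_kerE (hm : 3 ≤ m) (hf : IsLoc f M) {g : SL m S'[X]} (hg : g ∈ kerE m S') :
    ∃ s ∈ M, mp (sc (f s)) g ∈ (ElemSubgroup m S[X]).map (mp (mapRingHom f)) := by
  have scale : ∀ (s t : S) (x : SL m S'[X]),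
      mp (sc (f s)) x ∈ (ElemSubgroup m S[X]).map (mp (mapRingHom f)) →
      mp (sc (f (t * s))) x ∈ (ElemSubgroup m S[X]).map (mp (mapRingHom f)) := by
    rintro s t x ⟨e, he, h⟩
    refine ⟨mp (sc t) e, map_mem _ he, ?_⟩
    rw [mp_map_sc, h, mp_sc_sc, map_mul]
  induction hg using Subgroup.closure_induction with
  | one => exact ⟨1, M.one_mem, by simp [one_mem]⟩
  | mul x y _ _ hx hy =>
    obtain ⟨s, hs, h⟩ := hx
    obtain ⟨t, ht, h'⟩ := hy
    refine ⟨t * s, mul_mem ht hs, ?_⟩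
    rw [map_mul]
    refine mul_mem (scale _ _ _ h) ?_
    rw [mul_comm]
    exact scale _ _ _ h'
  | inv x _ hx =>
    obtain ⟨s, hs, h⟩ := hx
    exact ⟨s, hs, by rw [map_inv]; exact inv_mem h⟩
  | mem x hx =>
    obtain ⟨y, hy, i, j, h, p, rfl⟩ := hx
    obtain ⟨_, ⟨s, hs, rfl⟩, h1⟩ := conj_small_map hm hf.poly.surj (map_mem C hy)
    obtain ⟨_, ⟨t, ht, rfl⟩, c, hc⟩ := hf.poly.surj (sc (f s) p)
    refine ⟨t * s, mul_mem ht hs, ?_⟩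
    have h2 := h1 i j h (X * sc t c)
    convert h2 using 1
    have e1 : ∀ a : S', mp (sc a) (mp C y) = mp C y := fun a => by
      rw [map_map]; exact mp_congr (RingHom.ext (sc_C a)) y
    rw [map_mul, map_mul, map_inv, e1, map_el]
    congr 3
    simp only [map_mul, sc_X]
    have e2 : mapRingHom f (sc t c) = C (f t) * sc (f (t * s)) p := by
      rw [map_sc, hc, map_mul, sc_sc, ← map_mul]
      congr 1
      simp [sc_C]
    rw [e2]
    simp only [coe_mapRingHom, map_C, map_X, map_mul]
    ring

lemma dilation (hm : 3 ≤ m) (hf : IsLoc f M) {g : SL m S[X]} (h0 : mp (ev0 S) g = 1)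
    (hg : mp (mapRingHom f) g ∈ ElemSubgroup m S'[X]) :
    ∃ s ∈ M, mp (sc s) g ∈ ElemSubgroup m S[X] := by
  classical
  obtain ⟨s, hs, e, he, h⟩ := dilation_kerE hm hf (mem_kerE hg (by rw [mp_map_ev0, h0, map_one]))
  rw [← mp_map_sc] at h
  set g' := mp (sc s) g with hg'
  have g0 : mp (ev0 S) g' = 1 := by rw [hg', mp_ev0_sc, h0]
  set e' := e * (mp C (mp (ev0 S) e))⁻¹ with he'
  have e0 : mp (ev0 S) e' = 1 := by
    rw [he', map_mul, map_inv, mp_ev0_C, mul_inv_cancel]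
  have he'E : e' ∈ ElemSubgroup m S[X] := mul_mem he (inv_mem (map_mem _ (map_mem _ he)))
  have hmap : mp (mapRingHom f) e' = mp (mapRingHom f) g' := by
    have : mp f (mp (ev0 S) e) = 1 := by rw [← mp_map_ev0, h, mp_map_ev0, g0, map_one]
    rw [he', map_mul, map_inv, mp_map_C, this, map_one, inv_one, mul_one, h]
  obtain ⟨t, ht, hT⟩ := hf.ker_finset (Finset.univ.biUnion fun i : Fin m =>
      Finset.univ.biUnion fun j => (g'.1 i j - e'.1 i j).coeffs) fun a ha => by
    simp only [Finset.mem_biUnion, Finset.mem_univ, true_and] at ha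
    obtain ⟨i, j, ha⟩ := ha
    obtain ⟨n, _, rfl⟩ := mem_coeffs_iff.1 ha
    have := congrArg (fun x : SL m S'[X] => (x.1 i j).coeff n) hmap
    simp only [mp_apply, coe_mapRingHom, coeff_map] at this
    rw [coeff_sub, map_sub, this, sub_self]
  refine ⟨t * s, mul_mem ht hs, ?_⟩
  have : mp (sc (t * s)) g = mp (sc t) e' := by
    rw [← mp_sc_sc, ← hg']
    ext i j n
    change (sc t (g'.1 i j)).coeff n = (sc t (e'.1 i j)).coeff n
    rw [sc_coeff, sc_coeff, ← sub_eq_zero, ← sub_mul, ← coeff_sub]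
    rcases Nat.eq_zero_or_pos n with rfl | hn
    · have h1 := congrArg (fun x : SL m S => x.1 i j) (g0.trans e0.symm)
      simp only [mp_apply, coe_evalRingHom, ← coeff_zero_eq_eval_zero] at h1
      rw [coeff_sub, h1, sub_self, zero_mul]
    · by_cases hz : (g'.1 i j - e'.1 i j).coeff n = 0
      · rw [hz, zero_mul]
      · have := hT _ (Finset.mem_biUnion.2 ⟨i, Finset.mem_univ _, Finset.mem_biUnion.2
          ⟨j, Finset.mem_univ _, coeff_mem_coeffs hz⟩⟩)
        obtain ⟨n, rfl⟩ := Nat.exists_eq_succ_of_ne_zero hn.ne'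
        rw [pow_succ, mul_comm, mul_assoc, this, mul_zero]
  rw [this]
  exact map_mem _ he'E

end PolynomialKernel

section LocalGlobal

open Polynomial

variable {m : ℕ} {R : Type*} [CommRing R]

/-- The Quillen ideal of `g`. -/
noncomputable def quillenIdeal (g : SL m R[X]) : Ideal R where
  carrier := {s | ∀ x y : R[X], mp (compRingHom (x + C s * y)) g * (mp (compRingHom x) g)⁻¹ ∈
    ElemSubgroup m R[X]}
  zero_mem' x y := by simp [one_mem]
  add_mem' {s t} hs ht x y := by
    have := mul_mem (ht (x + C s * y) y) (hs x y)
    rw [← mul_assoc, inv_mul_cancel_right] at this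
    have e : x + C (s + t) * y = x + C s * y + C t * y := by rw [map_add]; ring
    rwa [e]
  smul_mem' r s hs x y := by
    have := hs x (C r * y)
    have e : x + C (r • s) * y = x + C s * (C r * y) := by rw [smul_eq_mul, map_mul]; ring
    rwa [e]

lemma exists_mem_quillenIdeal (hm : 3 ≤ m) (g : SL m R[X]) {R' : Type*} [CommRing R']
    {f : R →+* R'} {M : Submonoid R} (hf : IsLoc f M)
    (h : mp (mapRingHom f) g ∈ ElemSubgroup m R'[X]) : ∃ s ∈ M, s ∈ quillenIdeal g := by
  set tr : R[X] →+* R[X][X] := eval₂RingHom (C.comp C) (C X + X) with htr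
  set F : SL m R[X][X] := mp tr g * (mp C g)⁻¹ with hF
  have hF0 : mp (ev0 R[X]) F = 1 := by
    rw [hF, map_mul, map_inv, map_map, map_map, mul_inv_eq_one]
    refine mp_congr ?_ g
    ext <;> simp [htr]
  have hFE : mp (mapRingHom (mapRingHom f)) F ∈ ElemSubgroup m R'[X][X] := by
    rw [hF, map_mul, map_inv, mp_map_C, map_map]
    have : (mapRingHom (mapRingHom f)).comp tr =
        (eval₂RingHom (C.comp C) (C X + X) : R'[X] →+* R'[X][X]).comp (mapRingHom f) := by
      ext <;> simp [htr]
    rw [this, ← map_map]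
    exact mul_mem (map_mem _ h) (inv_mem (map_mem _ h))
  obtain ⟨_, ⟨s, hs, rfl⟩, h1⟩ := dilation hm hf.poly hF0 hFE
  refine ⟨s, hs, fun x y => ?_⟩
  have h2 := map_mem (eval₂RingHom (compRingHom x) y) h1
  convert h2 using 1
  rw [hF, map_mul, map_mul, map_inv, map_inv, map_map, map_map, map_map, map_map]
  congr 1
  · refine mp_congr ?_ g
    ext
    · simp [htr, sc_C]
    · simp [htr, sc_C, sc_X]
  · congr 1
    refine mp_congr ?_ g
    ext
    · simp [sc_C]
    · simp [sc_C]

theorem local_global (hm : 3 ≤ m) (g : SL m R[X]) (h0 : mp (ev0 R) g ∈ ElemSubgroup m R)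
    (h : ∀ (I : Ideal R) [I.IsMaximal],
      mp (mapRingHom (algebraMap R (Localization.AtPrime I))) g ∈
        ElemSubgroup m (Localization.AtPrime I)[X]) : g ∈ ElemSubgroup m R[X] := by
  have htop : quillenIdeal g = ⊤ := by
    by_contra hne
    obtain ⟨I, hI, hle⟩ := Ideal.exists_le_maximal _ hne
    obtain ⟨s, hs, hs'⟩ := exists_mem_quillenIdeal hm g
      (IsLoc.of_isLocalization I.primeCompl (S' := Localization.AtPrime I)) (h I)
    exact hs (hle hs')
  have h1 : (1 : R) ∈ quillenIdeal g := htop ▸ Submodule.mem_top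
  have h2 := h1 0 X
  have h3 := mul_mem h2 (map_mem C h0)
  convert h3 using 1
  rw [map_map]
  have e1 : compRingHom (0 + C 1 * X : R[X]) = RingHom.id _ := by ext <;> simp
  have e2 : compRingHom (0 : R[X]) = C.comp (ev0 R) := by ext <;> simp
  rw [e1, map_id, e2, inv_mul_cancel_right]

end LocalGlobal

section Factor

variable {m : ℕ} {S S₁ S₂ D : Type*} [CommRing S] [CommRing S₁] [CommRing S₂] [CommRing D]

/-- Over a ring obtained by inverting two comaximal elements, elementary matrices factor. -/
lemma factor (hm : 3 ≤ m) (g₁ : S →+* S₁) (g₂ : S →+* S₂) (f₁ : S₁ →+* D) (f₂ : S₂ →+* D)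
    (hfg : f₁.comp g₁ = f₂.comp g₂) (a b : S) (hab : IsCoprime a b)
    (h₁ : ∀ c, ∃ q : ℕ, ∃ x, f₁ x = f₁ (g₁ b) ^ q * c)
    (h₂ : ∀ c, ∃ q : ℕ, ∃ x, f₂ x = f₂ (g₂ a) ^ q * c)
    {e : SL m D} (he : e ∈ ElemSubgroup m D) :
    ∃ e₁ ∈ ElemSubgroup m S₁, ∃ e₂ ∈ ElemSubgroup m S₂, e = mp f₁ e₁ * mp f₂ e₂ := by
  have hloc : ∀ r : D, ∃ s ∈ Submonoid.powers (g₁ b), ∃ c, f₁ c = f₁ s * r := by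
    intro r
    obtain ⟨q, x, hx⟩ := h₁ r
    exact ⟨_, ⟨q, rfl⟩, x, by rw [hx, map_pow]⟩
  suffices h : ∀ e₁ ∈ ElemSubgroup m S₁, ∀ e₂ ∈ ElemSubgroup m S₂,
      ∃ e₁' ∈ ElemSubgroup m S₁, ∃ e₂' ∈ ElemSubgroup m S₂,
      mp f₁ e₁ * mp f₂ e₂ * e = mp f₁ e₁' * mp f₂ e₂' by
    obtain ⟨e₁, h1, e₂, h2, h⟩ := h 1 (one_mem _) 1 (one_mem _)
    exact ⟨e₁, h1, e₂, h2, by simpa using h⟩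
  refine elem_induction (p := fun e => ∀ e₁ ∈ ElemSubgroup m S₁, ∀ e₂ ∈ ElemSubgroup m S₂,
      ∃ e₁' ∈ ElemSubgroup m S₁, ∃ e₂' ∈ ElemSubgroup m S₂,
      mp f₁ e₁ * mp f₂ e₂ * e = mp f₁ e₁' * mp f₂ e₂') ?_ ?_ ?_ he
  · exact fun e₁ h1 e₂ h2 => ⟨e₁, h1, e₂, h2, mul_one _⟩
  · intro x y hx hy e₁ h1 e₂ h2
    obtain ⟨e₁', h1', e₂', h2', h⟩ := hx e₁ h1 e₂ h2
    obtain ⟨e₁'', h1'', e₂'', h2'', h'⟩ := hy e₁' h1' e₂' h2'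
    exact ⟨e₁'', h1'', e₂'', h2'', by rw [← mul_assoc, h, h']⟩
  · intro i j hij c e₁ h1 e₂ h2
    obtain ⟨_, ⟨K, rfl⟩, hK⟩ := conj_small_map hm hloc (map_mem f₂ h2)
    obtain ⟨q, x, hx⟩ := h₁ c
    obtain ⟨N, z, hz⟩ := h₂ c
    obtain ⟨Q, P, hPQ⟩ := (hab.pow (m := N) (n := K + q))
    have hc : c = f₁ (g₁ b ^ K * (g₁ P * x)) + f₂ (g₂ Q * z) := by
      have e1 : ∀ s, f₂ (g₂ s) = f₁ (g₁ s) := fun s => (RingHom.congr_fun hfg s).symm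
      have h3 := congrArg (fun s => f₁ (g₁ s)) hPQ
      simp only [map_add, map_mul, map_pow, map_one] at h3
      simp only [map_mul, map_pow, hx, hz, e1]
      linear_combination (-c) * h3
    obtain ⟨w, hw, hw'⟩ := hK i j hij (g₁ P * x)
    refine ⟨e₁ * w, mul_mem h1 hw, e₂ * el i j hij (g₂ Q * z), mul_mem h2 (el_mem _ _ _ _), ?_⟩
    rw [hc, el_add, (mp f₁).map_mul, (mp f₂).map_mul, hw', map_el]
    simp only [mul_assoc, inv_mul_cancel_left]

end Factor

section LocalRing

variable {m : ℕ} {A : Type*} [CommRing A]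

lemma sum_inv_mul (g : SL m A) (i j : Fin m) :
    ∑ k, (g⁻¹).1 i k * g.1 k j = if i = j then 1 else 0 := by
  have := congrArg (fun x : SL m A => x.1 i j) (inv_mul_cancel g)
  simp only [Matrix.SpecialLinearGroup.coe_mul, Matrix.mul_apply] at this
  rw [this]
  simp [Matrix.one_apply]

lemma sum_mul_inv (g : SL m A) (i j : Fin m) :
    ∑ k, g.1 i k * (g⁻¹).1 k j = if i = j then 1 else 0 := by
  simpa using sum_inv_mul g⁻¹ i j

variable [IsLocalRing A]

lemma exists_isUnit_of_sum {ι : Type*} {s : Finset ι} {f g : ι → A}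
    (h : ∑ i ∈ s, f i * g i = 1) : ∃ i ∈ s, IsUnit (g i) := by
  by_contra hne
  push Not at hne
  have : (∑ i ∈ s, f i * g i) ∈ IsLocalRing.maximalIdeal A :=
    sum_mem fun i hi => Ideal.mul_mem_left _ _ ((IsLocalRing.mem_maximalIdeal _).2 (hne i hi))
  rw [h] at this
  exact (Ideal.ne_top_iff_one _).1 (IsLocalRing.maximalIdeal.isMaximal A).ne_top this

lemma mul_apply' {S : Type*} [CommRing S] (g h : SL m S) (i j : Fin m) :
    (g * h).1 i j = ∑ k, g.1 i k * h.1 k j := rfl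

lemma el_mul_apply {S : Type*} [CommRing S] (k l : Fin m) (h : k ≠ l) (a : S) (g : SL m S)
    (i j : Fin m) : (el k l h a * g).1 i j = g.1 i j + if i = k then a * g.1 l j else 0 := by
  simp only [mul_apply', el_apply, add_mul, Finset.sum_add_distrib]
  by_cases hi : i = k
  · subst hi; simp
  · simp [hi, Ne.symm hi]

lemma conj_el_apply {S : Type*} [CommRing S] (g : SL m S) (k l : Fin m) (h : k ≠ l) (a : S)
    (i j : Fin m) : (g * el k l h a * g⁻¹).1 i j =
      (if i = j then 1 else 0) + g.1 i k * a * (g⁻¹).1 l j := by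
  have h1 : (g * el k l h a * g⁻¹ : SL m S).1 = (g * g⁻¹ : SL m S).1 +
      g.1 * Matrix.single k l a * (g⁻¹).1 := by
    simp only [Matrix.SpecialLinearGroup.coe_mul, coe_el, mul_add, add_mul, mul_one]
  rw [h1, mul_inv_cancel, Matrix.add_apply, Matrix.mul_apply,
    Finset.sum_eq_single l (fun b _ hb => by
      rw [Matrix.mul_single_apply_of_ne (hbj := hb), zero_mul]) (by simp),
    Matrix.mul_single_apply_same]
  simp only [Matrix.SpecialLinearGroup.coe_one, Matrix.one_apply]

lemma colSL_mul_apply {S : Type*} [CommRing S] (k : Fin m) (c : Fin m → S) (g : SL m S)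
    (i j : Fin m) : (colSL k c * g).1 i j = g.1 i j + if i ≠ k then c i * g.1 k j else 0 := by
  simp only [mul_apply', coe_colSL, add_mul, Finset.sum_add_distrib]
  by_cases hi : i = k
  · subst hi; simp
  · simp [hi]

lemma mul_rowSL_apply {S : Type*} [CommRing S] (k : Fin m) (c : Fin m → S) (g : SL m S)
    (i j : Fin m) : (g * rowSL k c).1 i j = g.1 i j + if j ≠ k then g.1 i k * c j else 0 := by
  simp only [mul_apply', coe_rowSL, mul_add, Finset.sum_add_distrib]
  by_cases hi : j = k
  · subst hi; simp
  · simp [hi]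

lemma mem_of_cleared (n : ℕ) : ∀ (s : Finset (Fin m)) (_ : sᶜ.card = n) (g : SL m A)
    (_ : ∀ j ∈ s, ∀ i, g.1 i j = if i = j then 1 else 0), g ∈ ElemSubgroup m A := by
  induction n with
  | zero =>
    intro s hs g hg
    have hs : s = Finset.univ := by simpa using hs
    have : g = 1 := by
      ext i j
      rw [hg j (by simp [hs]) i]; simp [Matrix.one_apply]
    rw [this]; exact one_mem _
  | succ n ih =>
    intro s hs g hg
    obtain ⟨c, hc⟩ : sᶜ.Nonempty := Finset.card_pos.1 (by omega)
    have hcs : c ∉ s := Finset.mem_compl.1 hc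
    -- it is enough to treat the case where the diagonal entry is `1`
    have main : ∀ g : SL m A, (∀ j ∈ s, ∀ i, g.1 i j = if i = j then 1 else 0) → g.1 c c = 1 →
        g ∈ ElemSubgroup m A := by
      intro g hg hgc
      have hE : colSL c (fun i => - g.1 i c) ∈ ElemSubgroup m A :=
        colSL_mem _ _ fun i hi => el_mem _ _ _ _
      rw [← Subgroup.mul_mem_cancel_left _ hE]
      refine ih (insert c s) ?_ _ ?_
      · rw [Finset.compl_insert, Finset.card_erase_of_mem hc, hs]; rfl
      · intro j hj i
        rw [colSL_mul_apply]
        rcases Finset.mem_insert.1 hj with rfl | hj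
        · rw [hgc]
          by_cases hi : i = j
          · subst hi; simp [hgc]
          · simp [hi]
        · have : c ≠ j := fun e => hcs (e ▸ hj)
          rw [hg j hj, hg j hj]
          simp [this]
    have main2 : ∀ g : SL m A, (∀ j ∈ s, ∀ i, g.1 i j = if i = j then 1 else 0) →
        ∀ p, p ∉ s → p ≠ c → IsUnit (g.1 p c) → g ∈ ElemSubgroup m A := by
      intro g hg p hp hpc hu
      obtain ⟨u, hu⟩ := hu
      rw [← Subgroup.mul_mem_cancel_left _
        (el_mem c p hpc.symm ((1 - g.1 c c) * (↑u⁻¹ : A)))]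
      refine main _ (fun j hj i => ?_) ?_
      · have : p ≠ j := fun e => hp (e ▸ hj)
        rw [el_mul_apply, hg j hj, hg j hj]
        simp [this]
      · rw [el_mul_apply, ← hu]
        simp
    have hz : ∀ j ∈ s, (g⁻¹).1 c j = 0 := by
      intro j hj
      have := sum_inv_mul g c j
      simp only [hg j hj] at this
      have hcj : c ≠ j := fun e => hcs (e ▸ hj)
      simpa [hcj] using this
    obtain ⟨k, hk, hu⟩ : ∃ k ∈ sᶜ, IsUnit (g.1 k c) := by
      refine exists_isUnit_of_sum (f := fun k => (g⁻¹).1 c k) ?_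
      have := sum_inv_mul g c c
      rw [if_pos rfl] at this
      refine (Finset.sum_subset (Finset.subset_univ _) fun x _ hx => ?_).trans this
      rw [hz x (by simpa using hx), zero_mul]
    by_cases hkc : k = c
    · subst hkc
      by_cases hp : ∃ p, p ∉ s ∧ p ≠ k
      · obtain ⟨p, hp, hpk⟩ := hp
        obtain ⟨u, hu⟩ := hu
        rw [← Subgroup.mul_mem_cancel_left _
          (el_mem p k hpk ((1 - g.1 p k) * (↑u⁻¹ : A)))]
        refine main2 _ (fun j hj i => ?_) p hp hpk ?_
        · have : k ≠ j := fun e => hcs (e ▸ hj)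
          rw [el_mul_apply, hg j hj, hg j hj]
          simp [this]
        · rw [el_mul_apply, ← hu]
          simp
      · push Not at hp
        refine main g hg ?_
        have h1 : (g : Matrix (Fin m) (Fin m) A) =
            (1 : Matrix (Fin m) (Fin m) A).updateCol k (fun i => g.1 i k) := by
          ext i j
          rw [Matrix.updateCol_apply]
          by_cases hj : j = k
          · simp [hj]
          · have : j ∈ s := by by_contra h; exact hj (hp j h)
            rw [if_neg hj, hg j this, Matrix.one_apply]
        have h2 := g.2
        rw [h1, ← Matrix.cramer_apply, Matrix.cramer_one] at h2
        exact h2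
    · exact main2 g hg k (by simpa using hk) hkc hu

/-- Over a local ring, `SL_m = E_m`. -/
theorem mem_of_isLocalRing (g : SL m A) : g ∈ ElemSubgroup m A :=
  mem_of_cleared _ ∅ rfl g (by simp)

end LocalRing

section InvT

variable {m : ℕ} {A : Type*} [CommRing A]

lemma invT_mem {g : SL m A} (hg : g ∈ ElemSubgroup m A) : invT g ∈ ElemSubgroup m A :=
  elem_le (Q := (ElemSubgroup m A).comap invT)
    (fun i j h a => by rw [Subgroup.mem_comap, invT_el]; exact el_mem _ _ _ _) hg

end InvT

section Parabolic

open Polynomial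

variable {m : ℕ} {A : Type*} [CommRing A]

/-- Generated by the `e_{ij}(p)` with `X ∣ p` when `j = o`. -/
noncomputable def colPar (A : Type*) [CommRing A] (o : Fin m) : Subgroup (SL m A[X]) :=
  Subgroup.closure {g | ∃ i j, ∃ h : i ≠ j, ∃ p, (j = o → X ∣ p) ∧ g = el i j h p}

/-- Generated by the `e_{ij}(p)` with `X ∣ p` when `i = o`. -/
noncomputable def rowPar (A : Type*) [CommRing A] (o : Fin m) : Subgroup (SL m A[X]) :=
  Subgroup.closure {g | ∃ i j, ∃ h : i ≠ j, ∃ p, (i = o → X ∣ p) ∧ g = el i j h p}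

lemma el_mem_colPar {o i j : Fin m} (h : i ≠ j) {p : A[X]} (hp : j = o → X ∣ p) :
    el i j h p ∈ colPar A o :=
  Subgroup.subset_closure ⟨i, j, h, p, hp, rfl⟩

lemma colPar_le_invT (o : Fin m) : colPar A o ≤ (rowPar A o).comap invT := by
  refine (Subgroup.closure_le _).2 ?_
  rintro _ ⟨i, j, h, p, hp, rfl⟩
  refine Subgroup.subset_closure ⟨j, i, h.symm, -p, fun e => (hp e).neg_right, invT_el _ _ _ _⟩

lemma conj_col_mem_colPar (hm : 3 ≤ m) (o : Fin m) (c : Fin m → A[X]) (l : Fin m) (hl : l ≠ o)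
    (q : A[X]) :
    colSL o c * el o l hl.symm (X * q) * (colSL o c)⁻¹ ∈ colPar A o := by
  set x := X * q with hx
  have hXx : X ∣ x := ⟨q, rfl⟩
  set c' := Function.update c l 0 with hc'
  have h1 : colSL o c = el l o hl (c l) * colSL o c' := by
    rw [← colSL_single, ← colSL_add]
    congr 1
    ext1 i
    by_cases hi : i = l
    · subst hi; simp [hc']
    · simp [hc', hi]
  set d : Fin m → A[X] := fun i => if i = o then x else c' i * x with hd
  have h2 : colSL o c' * el o l hl.symm x * (colSL o c')⁻¹ = colSL l d := by
    rw [mul_inv_eq_iff_eq_mul]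
    refine ext_val (Matrix.ext fun i j => ?_)
    have e1 := colSL_mul_apply o c' (el o l hl.symm x) i j
    have e2 := colSL_mul_apply l d (colSL o c') i j
    refine e1.trans (Eq.trans ?_ e2.symm)
    simp only [el_apply, coe_colSL, hd]
    have hcl : c' l = 0 := by simp [hc']
    grind
  have h3 : colSL o c * el o l hl.symm x * (colSL o c)⁻¹ =
      el l o hl (c l) * colSL l d * (el l o hl (c l))⁻¹ := by
    rw [← h2, h1]; group
  rw [h3]
  have hdX : ∀ i, X ∣ d i := fun i => by
    by_cases hi : i = o
    · simp [hd, hi, hXx]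
    · simp [hd, hi, hXx.mul_left]
  refine colSL_mem (Q := (colPar A o).comap (MulAut.conj (el l o hl (c l))).toMonoidHom) l d
    fun i hi => ?_
  rw [Subgroup.mem_comap]
  change el l o hl (c l) * el i l hi (d i) * (el l o hl (c l))⁻¹ ∈ colPar A o
  rw [← el_neg]
  by_cases hio : i = o
  · subst hio
    obtain ⟨p, hpo, hpl⟩ := exists_ne_ne hm i l
    rw [← one_mul (d i), el_mul_eq_commutator hi hpo.symm hpl]
    have c1 : ∀ a, el l i hl (c l) * el i p hpo.symm a * el l i hl (-(c l)) ∈ colPar A i :=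
      fun a => by
        rw [conj_left hpo.symm hl hpl.symm]
        exact mul_mem (el_mem_colPar _ fun e => absurd e hpo) (el_mem_colPar _ fun e => absurd e hpo)
    have c2 : ∀ a, X ∣ a → el l i hl (c l) * el p l hpl a * el l i hl (-(c l)) ∈ colPar A i :=
      fun a ha => by
        rw [conj_right hpl hl hpo]
        exact mul_mem (el_mem_colPar _ fun e => absurd e hl)
          (el_mem_colPar _ fun _ => (ha.mul_right _).neg_right)
    have := mul_mem (mul_mem (mul_mem (c1 1) (c2 _ (hdX i))) (c1 (-1))) (c2 _ ((hdX i).neg_right))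
    convert this using 1
    simp only [el_neg]
    group
  · rw [conj_right hi hl hio]
    exact mul_mem (el_mem_colPar _ fun e => absurd e hl)
      (el_mem_colPar _ fun _ => ((hdX i).mul_right _).neg_right)

lemma conj_row_mem_colPar (hm : 3 ≤ m) (o k : Fin m) (c q : Fin m → A[X]) :
    colSL k c * rowSL k (fun i => X * q i) * (colSL k c)⁻¹ ∈ colPar A o := by
  by_cases hk : k = o
  · subst hk
    refine rowSL_mem (Q := (colPar A k).comap (MulAut.conj (colSL k c)).toMonoidHom) k _
      fun i hi => ?_
    rw [Subgroup.mem_comap]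
    exact conj_col_mem_colPar hm k c i hi (q i)
  · have h1 : colSL k c ∈ colPar A o := colSL_mem _ _ fun i hi => el_mem_colPar _ fun e => absurd e hk
    have h2 : rowSL k (fun i => X * q i) ∈ colPar A o :=
      rowSL_mem _ _ fun i hi => el_mem_colPar _ fun _ => ⟨_, rfl⟩
    exact mul_mem (mul_mem h1 h2) (inv_mem h1)

lemma invT_kerE {g : SL m A[X]} (hg : g ∈ kerE m A) : invT g ∈ kerE m A := by
  have : kerE m A ≤ (kerE m A).comap invT := by
    refine (Subgroup.closure_le _).2 ?_
    rintro _ ⟨y, hy, i, j, hij, p, rfl⟩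
    refine Subgroup.subset_closure ⟨invT y, invT_mem hy, j, i, hij.symm, -p, ?_⟩
    rw [map_mul, map_mul, map_inv, invT_el, map_invT, mul_neg]
  exact this hg

variable [IsLocalRing A]

lemma kerE_le_colPar (hm : 3 ≤ m) (o : Fin m) : kerE m A ≤ colPar A o := by
  refine (Subgroup.closure_le _).2 ?_
  rintro _ ⟨y, -, i, j, hij, p, rfl⟩
  obtain ⟨k, -, u, hu⟩ := exists_isUnit_of_sum (s := Finset.univ)
    (f := fun k => (y⁻¹).1 i k) (g := fun k => y.1 k i) (by rw [sum_inv_mul, if_pos rfl])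
  set c : Fin m → A := fun a => y.1 a i * (↑u⁻¹ : A) with hc
  set y' : SL m A := (colSL k c)⁻¹ * y with hy'
  have hcol : ∀ a, y'.1 a i = if a = k then (u : A) else 0 := by
    intro a
    rw [hy', ← colSL_neg, colSL_mul_apply]
    by_cases ha : a = k
    · subst ha; simp [hu]
    · simp [ha, hc, ← hu]
  have hw : (y'⁻¹).1 j k = 0 := by
    have := sum_inv_mul y' j i
    simp only [hcol, if_neg hij.symm] at this
    simpa using this
  have key : mp C y' * el i j hij (X * p) * (mp C y')⁻¹ =
      rowSL k (fun l => X * (p * C (u * (y'⁻¹).1 j l))) := by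
    refine ext_val (Matrix.ext fun a b => ?_)
    refine (conj_el_apply _ _ _ hij _ a b).trans ?_
    rw [← map_inv, mp_apply, mp_apply, hcol, coe_rowSL]
    congr 1
    by_cases hb : b = k
    · subst hb; simp [hw]
    · by_cases ha : a = k
      · simp only [ha, hb, if_true, ne_eq, not_false_eq_true, and_self, map_mul]; ring
      · simp [ha]
  have : mp C y * el i j hij (X * p) * (mp C y)⁻¹ = colSL k (fun a => C (c a)) *
      rowSL k (fun l => X * (p * C (u * (y'⁻¹).1 j l))) * (colSL k (fun a => C (c a)))⁻¹ := by
    rw [← key, ← map_colSL, hy', map_mul, map_inv]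
    group
  rw [SetLike.mem_coe, this]
  exact conj_row_mem_colPar hm o k _ _

lemma kerE_le_rowPar (hm : 3 ≤ m) (o : Fin m) : kerE m A ≤ rowPar A o := fun g hg => by
  have := colPar_le_invT o (kerE_le_colPar hm o (invT_kerE hg))
  rwa [Subgroup.mem_comap, invT_invT] at this

end Parabolic

section Gauss

variable {m : ℕ} {A : Type*} [CommRing A] [IsLocalRing A]

lemma residue_apply_of_eq_one {γ : SL m A} (h : mp (IsLocalRing.residue A) γ = 1) (i j : Fin m) :
    IsLocalRing.residue A (γ.1 i j) = if i = j then 1 else 0 := by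
  have := congrArg (fun x : SL m (IsLocalRing.ResidueField A) => x.1 i j) h
  simp only [mp_apply] at this
  rw [this]; simp [Matrix.one_apply]

/-- Block factorization of an invertible matrix congruent to the identity. -/
lemma gauss (o : Fin m) (γ : SL m A) (h : mp (IsLocalRing.residue A) γ = 1) :
    ∃ r u : Fin m → A, ∃ q : SL m A, γ = rowSL o r * q * colSL o u ∧
      (∀ i, i ≠ o → IsLocalRing.residue A (r i) = 0) ∧
      (∀ i, i ≠ o → IsLocalRing.residue A (u i) = 0) ∧
      ∀ j, j ≠ o → q.1 o j = 0 ∧ q.1 j o = 0 := by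
  have hres := residue_apply_of_eq_one (γ := γ⁻¹) (by rw [map_inv, h, inv_one])
  obtain ⟨v, hv⟩ : IsUnit ((γ⁻¹).1 o o) := by
    rw [← IsLocalRing.residue_ne_zero_iff_isUnit, hres]; simp
  set u : Fin m → A := fun i => (γ⁻¹).1 i o * (↑v⁻¹ : A) with hu
  set r : Fin m → A := fun j => (γ⁻¹).1 o j * (↑v⁻¹ : A) with hr
  set q := (colSL o u)⁻¹ * γ⁻¹ * (rowSL o r)⁻¹ with hq
  have hrow : (rowSL o r)⁻¹ = rowSL o (-r) := by
    rw [rowSL_eq_invT, rowSL_eq_invT, ← map_inv, ← colSL_neg]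
  have hqe : ∀ i j, q.1 i j = ((γ⁻¹).1 i j + if i ≠ o then -u i * (γ⁻¹).1 o j else 0) +
      if j ≠ o then -(((γ⁻¹).1 i o + if i ≠ o then -u i * (γ⁻¹).1 o o else 0) * r j) else 0 := by
    intro i j
    rw [hq, hrow, mul_rowSL_apply, ← colSL_neg, colSL_mul_apply, colSL_mul_apply]
    simp
  have hq0 : ∀ j, j ≠ o → q.1 o j = 0 ∧ q.1 j o = 0 := by
    intro j hj
    rw [hqe, hqe]
    simp [hj, hu, hr, ← hv]
    ring_nf
    simp
  have hq' : q⁻¹ = rowSL o r * γ * colSL o u := by rw [hq]; group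
  refine ⟨-r, -u, q⁻¹, ?_, fun i hi => ?_, fun i hi => ?_, fun j hj => ?_⟩
  · rw [hq', ← hrow, colSL_neg]; group
  · rw [Pi.neg_apply, map_neg, hr, map_mul, hres, if_neg hi.symm, zero_mul, neg_zero]
  · rw [Pi.neg_apply, map_neg, hu, map_mul, hres, if_neg hi, zero_mul, neg_zero]
  · have hqo : IsUnit (q.1 o o) := by
      rw [hqe]; simp [← hv]
    obtain ⟨w, hw⟩ := hqo
    constructor
    · have h1 := sum_mul_inv q o j
      rw [Finset.sum_eq_single o (fun b _ hb => by rw [(hq0 b hb).1, zero_mul]) (by simp),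
        if_neg hj.symm, ← hw] at h1
      simpa using h1
    · have h1 := sum_inv_mul q j o
      rw [Finset.sum_eq_single o (fun b _ hb => by rw [(hq0 b hb).2, mul_zero]) (by simp),
        if_neg hj, ← hw] at h1
      simpa using h1

end Gauss

section Laurent

open Polynomial LaurentPolynomial

variable {A B : Type*} [CommRing A] [CommRing B]

/-- Substitution `X ↦ T⁻¹`. -/
noncomputable def toLaurentInv (A : Type*) [CommRing A] : A[X] →+* A[T;T⁻¹] :=
  (LaurentPolynomial.invert (R := A)).toRingEquiv.toRingHom.comp Polynomial.toLaurent

lemma toLaurentInv_apply (p : A[X]) : toLaurentInv A p = invert (toLaurent p) := rfl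

lemma toLaurentInv_C (a : A) : toLaurentInv A (Polynomial.C a) = LaurentPolynomial.C a := by
  rw [toLaurentInv_apply, toLaurent_C, invert_C]

lemma toLaurentInv_X : toLaurentInv A X = T (-1) := by
  rw [toLaurentInv_apply, toLaurent_X, invert_T]

lemma toLaurentInv_injective : Function.Injective (toLaurentInv A) :=
  (LaurentPolynomial.invert (R := A)).injective.comp Polynomial.toLaurent_injective

lemma toLaurent_coeff (p : A[X]) (n : ℕ) : (toLaurent p).coeff (n : ℤ) = p.coeff n := by
  rw [coeff_toLaurent]
  exact Finsupp.mapDomain_apply Nat.castEmbedding.injective _ _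

lemma toLaurent_coeff_neg (p : A[X]) {n : ℤ} (hn : n < 0) : (toLaurent p).coeff n = 0 := by
  rw [coeff_toLaurent]
  refine Finsupp.mapDomain_of_notMem_range _ _ ?_
  rintro ⟨k, rfl⟩
  simp at hn
  omega

lemma toLaurentInv_coeff_pos (p : A[X]) {n : ℤ} (hn : 0 < n) : (toLaurentInv A p).coeff n = 0 := by
  rw [toLaurentInv_apply, invert_apply]
  exact toLaurent_coeff_neg p (by omega)

lemma eq_C_of_toLaurent_eq {p q : A[X]} (h : toLaurent p = toLaurentInv A q) :
    p = Polynomial.C (p.coeff 0) := by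
  ext n
  rcases Nat.eq_zero_or_pos n with rfl | hn
  · simp
  · rw [← toLaurent_coeff, h, toLaurentInv_coeff_pos q (by omega), Polynomial.coeff_C,
      if_neg (by omega)]

/-- Change of coefficients for Laurent polynomials. -/
noncomputable def lmap (f : A →+* B) : A[T;T⁻¹] →+* B[T;T⁻¹] :=
  AddMonoidAlgebra.mapRingHom ℤ f

lemma lmap_C (f : A →+* B) (a : A) : lmap f (LaurentPolynomial.C a) = LaurentPolynomial.C (f a) :=
  AddMonoidAlgebra.mapRingHom_single ..

lemma lmap_T (f : A →+* B) (n : ℤ) : lmap f (T n) = T n :=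
  (AddMonoidAlgebra.mapRingHom_single ..).trans (by rw [map_one]; rfl)

lemma lmap_comp_toLaurent (f : A →+* B) :
    (lmap f).comp toLaurent = toLaurent.comp (mapRingHom f) := by
  refine Polynomial.ringHom_ext (fun a => ?_) ?_
  · simp [lmap_C]
  · simp [lmap_T]

lemma lmap_comp_toLaurentInv (f : A →+* B) :
    (lmap f).comp (toLaurentInv A) = (toLaurentInv B).comp (mapRingHom f) := by
  refine Polynomial.ringHom_ext (fun a => ?_) ?_
  · simp [lmap_C, toLaurentInv_C]
  · simp [lmap_T, toLaurentInv_X]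

end Laurent

section GLSetup

open Polynomial LaurentPolynomial

variable {m : ℕ} {A B : Type*} [CommRing A] [CommRing B]

/-- `GL_m` of the Laurent polynomial ring. -/
abbrev LGL (m : ℕ) (A : Type*) [CommRing A] := GL (Fin m) A[T;T⁻¹]

/-- The inclusion of `SL_m` into `GL_m`. -/
abbrev toG {S : Type*} [CommRing S] : SL m S →* GL (Fin m) S := Matrix.SpecialLinearGroup.toGL

lemma toG_apply {S : Type*} [CommRing S] (g : SL m S) (i j : Fin m) :
    (toG g).1 i j = g.1 i j := rfl

/-- The map on `SL_m` given by `X ↦ T`. -/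
noncomputable def iP : SL m A[X] →* LGL m A := toG.comp (mp toLaurent)

/-- The map on `SL_m` given by `X ↦ T⁻¹`. -/
noncomputable def iM : SL m A[X] →* LGL m A := toG.comp (mp (toLaurentInv A))

/-- The inclusion of constant matrices. -/
noncomputable def iC : SL m A →* LGL m A := toG.comp (mp LaurentPolynomial.C)

lemma iP_injective : Function.Injective (iP (m := m) (A := A)) :=
  Matrix.SpecialLinearGroup.toGL_injective.comp (map_injective Polynomial.toLaurent_injective)

lemma iM_injective : Function.Injective (iM (m := m) (A := A)) :=
  Matrix.SpecialLinearGroup.toGL_injective.comp (map_injective toLaurentInv_injective)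

lemma iP_C (g : SL m A) : iP (mp Polynomial.C g) = iC g := by
  change toG _ = toG _
  congr 1
  rw [map_map]
  exact mp_congr (RingHom.ext toLaurent_C) g

lemma iM_C (g : SL m A) : iM (mp Polynomial.C g) = iC g := by
  change toG _ = toG _
  congr 1
  rw [map_map]
  exact mp_congr (RingHom.ext toLaurentInv_C) g

lemma iP_el (i j : Fin m) (h : i ≠ j) (p : A[X]) : iP (el i j h p) = toG (el i j h (toLaurent p)) :=
  congrArg toG (map_el ..)

lemma iM_el (i j : Fin m) (h : i ≠ j) (p : A[X]) :
    iM (el i j h p) = toG (el i j h (toLaurentInv A p)) :=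
  congrArg toG (map_el ..)

lemma iC_el (i j : Fin m) (h : i ≠ j) (a : A) :
    iC (el i j h a) = toG (el i j h (LaurentPolynomial.C a)) :=
  congrArg toG (map_el ..)

/-- The diagonal matrix with entries `T ^ μ i`. -/
noncomputable def dg (μ : Fin m → ℤ) : LGL m A where
  val := Matrix.diagonal fun i => T (μ i)
  inv := Matrix.diagonal fun i => T (- μ i)
  val_inv := by
    simp only [Matrix.diagonal_mul_diagonal, ← T_add, add_neg_cancel, T_zero, Matrix.diagonal_one]
  inv_val := by
    simp only [Matrix.diagonal_mul_diagonal, ← T_add, neg_add_cancel, T_zero, Matrix.diagonal_one]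

lemma dg_add (μ ν : Fin m → ℤ) : dg (A := A) (μ + ν) = dg μ * dg ν := by
  refine Units.ext ?_
  change Matrix.diagonal _ = Matrix.diagonal _ * Matrix.diagonal _
  simp only [Matrix.diagonal_mul_diagonal, ← T_add, Pi.add_apply]

lemma dg_zero : dg (A := A) (0 : Fin m → ℤ) = 1 := by
  refine Units.ext ?_
  change Matrix.diagonal _ = 1
  simp

lemma dg_neg (μ : Fin m → ℤ) : dg (A := A) (-μ) = (dg μ)⁻¹ := by
  rw [eq_inv_iff_mul_eq_one, ← dg_add, neg_add_cancel, dg_zero]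

lemma dg_mul_apply (μ : Fin m → ℤ) (g : LGL m A) (i j : Fin m) :
    (dg μ * g).1 i j = T (μ i) * g.1 i j := by
  exact Matrix.diagonal_mul (fun i => (T (μ i) : A[T;T⁻¹])) g.1 i j

lemma mul_dg_apply (μ : Fin m → ℤ) (g : LGL m A) (i j : Fin m) :
    (g * dg μ).1 i j = g.1 i j * T (μ j) := by
  exact Matrix.mul_diagonal (fun i => (T (μ i) : A[T;T⁻¹])) g.1 i j

lemma dg_conj_apply (μ : Fin m → ℤ) (g : LGL m A) (i j : Fin m) :
    (dg μ * g * (dg μ)⁻¹).1 i j = T (μ i - μ j) * g.1 i j := by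
  rw [← dg_neg, mul_dg_apply, dg_mul_apply, sub_eq_add_neg, T_add, Pi.neg_apply]
  ring

lemma dg_conj_el (μ : Fin m → ℤ) (i j : Fin m) (h : i ≠ j) (a : A[T;T⁻¹]) :
    dg μ * toG (el i j h a) * (dg μ)⁻¹ = toG (el i j h (T (μ i - μ j) * a)) := by
  refine Units.ext (Matrix.ext fun p q => ?_)
  refine (dg_conj_apply μ _ p q).trans ?_
  rw [toG_apply, toG_apply, el_apply, el_apply]
  by_cases hpq : p = q
  · subst hpq
    have : ¬ (i = p ∧ j = p) := by rintro ⟨rfl, rfl⟩; exact h rfl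
    simp [this]
  · by_cases h' : i = p ∧ j = q
    · obtain ⟨rfl, rfl⟩ := h'; simp [h]
    · simp [hpq, h']

lemma dg_const_central (c : ℤ) (g : LGL m A) :
    dg (fun _ => c) * g * (dg fun _ => c)⁻¹ = g := by
  refine Units.ext (Matrix.ext fun p q => ?_)
  refine (dg_conj_apply _ _ p q).trans ?_
  simp

/-- A submonoid containing the diagonal matrices `T` and those with a single entry `T`
contains all `dg μ`. -/
lemma dg_mem_of_generators (Q : Submonoid (LGL m A)) (hc : ∀ c : ℤ, dg (fun _ => c) ∈ Q)
    (hs : ∀ o : Fin m, dg (Pi.single o 1) ∈ Q) (μ : Fin m → ℤ) : dg μ ∈ Q := by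
  have h1 : ∀ o, ∀ n : ℕ, dg (Pi.single o (n : ℤ)) ∈ Q := by
    intro o n
    induction n with
    | zero => simp [dg_zero]
    | succ n ih =>
      rw [Nat.cast_succ, Pi.single_add, dg_add]
      exact Q.mul_mem ih (hs o)
  have h2 : ∀ (ν : Fin m → ℕ) (s : Finset (Fin m)),
      dg (∑ i ∈ s, Pi.single i (ν i : ℤ)) ∈ Q := by
    intro ν s
    induction s using Finset.induction_on with
    | empty => simp [dg_zero]
    | insert a s ha ih =>
      rw [Finset.sum_insert ha, dg_add]
      exact Q.mul_mem (h1 a _) ih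
  set N : ℤ := ∑ i, |μ i| with hN
  have hle : ∀ i, 0 ≤ μ i + N := fun i => by
    have : |μ i| ≤ N := Finset.single_le_sum (fun j _ => abs_nonneg (μ j)) (Finset.mem_univ i)
    have := neg_abs_le (μ i)
    omega
  have h3 := h2 (fun i => (μ i + N).toNat) Finset.univ
  rw [Finset.univ_sum_single (fun i => (((μ i + N).toNat : ℕ) : ℤ))] at h3
  have h4 : μ = (fun _ => -N) + fun i => (((μ i + N).toNat : ℕ) : ℤ) := by
    ext i
    simp only [Pi.add_apply, Int.toNat_of_nonneg (hle i)]
    ring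
  rw [h4, dg_add]
  exact Q.mul_mem (hc _) h3

/-- A submonoid containing the constant elementary matrices and all `dg μ` contains `E_m`. -/
lemma toG_mem_of_generators (Q : Submonoid (LGL m A)) (hc : ∀ g : SL m A, iC g ∈ Q)
    (hd : ∀ μ : Fin m → ℤ, dg μ ∈ Q) {e : SL m A[T;T⁻¹]} (he : e ∈ ElemSubgroup m A[T;T⁻¹]) :
    toG e ∈ Q := by
  refine elem_induction (p := fun e => toG e ∈ Q) (by simp)
    (fun x y hx hy => by rw [map_mul]; exact Q.mul_mem hx hy) (fun i j h a => ?_) he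
  induction a using LaurentPolynomial.induction_on' with
  | add p q hp hq => rw [el_add, map_mul]; exact Q.mul_mem hp hq
  | C_mul_T n a =>
    have := dg_conj_el (Pi.single i n) i j h (LaurentPolynomial.C a)
    rw [← iC_el, Pi.single_eq_same, Pi.single_eq_of_ne h.symm, sub_zero, mul_comm, ← dg_neg] at this
    rw [← this]
    exact Q.mul_mem (Q.mul_mem (hd _) (hc _)) (hd _)

/-- Change of coefficients. -/
noncomputable def rho (f : A →+* B) : LGL m A →* LGL m B := Matrix.GeneralLinearGroup.map (lmap f)

lemma rho_apply (f : A →+* B) (g : LGL m A) (i j : Fin m) :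
    (rho f g).1 i j = lmap f (g.1 i j) := rfl

lemma rho_iP (f : A →+* B) (g : SL m A[X]) : rho f (iP g) = iP (mp (mapRingHom f) g) :=
  Units.ext (Matrix.ext fun i j => RingHom.congr_fun (lmap_comp_toLaurent f) (g.1 i j))

lemma rho_iM (f : A →+* B) (g : SL m A[X]) : rho f (iM g) = iM (mp (mapRingHom f) g) :=
  Units.ext (Matrix.ext fun i j => RingHom.congr_fun (lmap_comp_toLaurentInv f) (g.1 i j))

lemma rho_iC (f : A →+* B) (g : SL m A) : rho f (iC g) = iC (mp f g) :=
  Units.ext (Matrix.ext fun i j => lmap_C f (g.1 i j))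

lemma rho_dg (f : A →+* B) (μ : Fin m → ℤ) : rho f (dg μ) = dg μ := by
  refine Units.ext (Matrix.ext fun i j => ?_)
  rw [rho_apply]
  change lmap f (Matrix.diagonal _ i j) = Matrix.diagonal _ i j
  by_cases h : i = j
  · subst h; simp [lmap_T]
  · simp [h]

end GLSetup

open Polynomial LaurentPolynomial

section Parabolic

variable {m : ℕ} {A : Type*} [CommRing A]

/-- The image of `E_m(A[X])` under `X ↦ T`. -/
noncomputable def EP (m : ℕ) (A : Type*) [CommRing A] : Subgroup (LGL m A) :=
  (ElemSubgroup m A[X]).map iP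

/-- The image of `E_m(A[X])` under `X ↦ T⁻¹`. -/
noncomputable def EM (m : ℕ) (A : Type*) [CommRing A] : Subgroup (LGL m A) :=
  (ElemSubgroup m A[X]).map iM

/-- The diagonal matrix with a single entry `T`. -/
noncomputable def tau (o : Fin m) : LGL m A := dg (Pi.single o 1)

/-- The elements `x` of `Q` with `y * x * y⁻¹` in `Q`. -/
def stab {G : Type*} [Group G] (Q : Subgroup G) (y : G) : Subgroup G :=
  Q ⊓ Q.comap (MulAut.conj y).toMonoidHom

lemma mem_stab {G : Type*} [Group G] {Q : Subgroup G} {x y : G} :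
    x ∈ stab Q y ↔ x ∈ Q ∧ y * x * y⁻¹ ∈ Q := Iff.rfl

lemma iP_mem_EP {g : SL m A[X]} (hg : g ∈ ElemSubgroup m A[X]) : iP g ∈ EP m A := ⟨g, hg, rfl⟩

lemma iM_mem_EM {g : SL m A[X]} (hg : g ∈ ElemSubgroup m A[X]) : iM g ∈ EM m A := ⟨g, hg, rfl⟩

lemma iP_colPar_mem {o : Fin m} {g : SL m A[X]} (hg : g ∈ colPar A o) :
    iP g ∈ stab (EP m A) (tau o) := by
  have : colPar A o ≤ (stab (EP m A) (tau o)).comap iP := by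
    refine (Subgroup.closure_le _).2 ?_
    rintro _ ⟨i, j, h, p, hp, rfl⟩
    rw [SetLike.mem_coe, Subgroup.mem_comap, mem_stab]
    refine ⟨iP_mem_EP (el_mem _ _ _ _), ?_⟩
    rw [iP_el, tau, dg_conj_el]
    by_cases hj : j = o
    · obtain ⟨q, rfl⟩ := hp hj
      subst hj
      rw [Pi.single_eq_same, Pi.single_eq_of_ne h, map_mul, toLaurent_X, ← mul_assoc, ← T_add]
      norm_num
      rw [← iP_el]
      exact iP_mem_EP (el_mem _ _ _ _)
    · rw [Pi.single_eq_of_ne hj, sub_zero]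
      by_cases hi : i = o
      · subst hi
        rw [Pi.single_eq_same, ← toLaurent_X, ← map_mul, ← iP_el]
        exact iP_mem_EP (el_mem _ _ _ _)
      · rw [Pi.single_eq_of_ne hi, T_zero, one_mul, ← iP_el]
        exact iP_mem_EP (el_mem _ _ _ _)
  exact this hg

lemma iM_rowPar_mem {o : Fin m} {g : SL m A[X]} (hg : g ∈ rowPar A o) :
    iM g ∈ stab (EM m A) (tau o) := by
  have : rowPar A o ≤ (stab (EM m A) (tau o)).comap iM := by
    refine (Subgroup.closure_le _).2 ?_
    rintro _ ⟨i, j, h, p, hp, rfl⟩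
    rw [SetLike.mem_coe, Subgroup.mem_comap, mem_stab]
    refine ⟨iM_mem_EM (el_mem _ _ _ _), ?_⟩
    rw [iM_el, tau, dg_conj_el]
    by_cases hi : i = o
    · obtain ⟨q, rfl⟩ := hp hi
      subst hi
      rw [Pi.single_eq_same, Pi.single_eq_of_ne h.symm, map_mul, toLaurentInv_X, ← mul_assoc,
        ← T_add]
      norm_num
      rw [← iM_el]
      exact iM_mem_EM (el_mem _ _ _ _)
    · rw [Pi.single_eq_of_ne hi, zero_sub]
      by_cases hj : j = o
      · subst hj
        rw [Pi.single_eq_same, ← toLaurentInv_X, ← map_mul, ← iM_el]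
        exact iM_mem_EM (el_mem _ _ _ _)
      · rw [Pi.single_eq_of_ne hj, neg_zero, T_zero, one_mul, ← iM_el]
        exact iM_mem_EM (el_mem _ _ _ _)
  exact this hg

lemma iC_rowSL_mem (o : Fin m) (r : Fin m → A) : iC (rowSL o r) ∈ stab (EP m A) (tau o) := by
  rw [← iP_C, map_rowSL]
  exact iP_colPar_mem (rowSL_mem _ _ fun i hi => el_mem_colPar _ fun e => absurd e hi)

lemma iC_colSL_mem (o : Fin m) (r : Fin m → A) : iC (colSL o r) ∈ stab (EM m A) (tau o) := by
  rw [← iM_C, map_colSL]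
  exact iM_rowPar_mem (colSL_mem _ _ fun i hi =>
    Subgroup.subset_closure ⟨_, _, _, _, fun e => absurd e hi, rfl⟩)

lemma tau_conj_iC (o : Fin m) {q : SL m A} (hq : ∀ j, j ≠ o → q.1 o j = 0 ∧ q.1 j o = 0) :
    tau o * iC q * (tau o)⁻¹ = iC q := by
  refine Units.ext (Matrix.ext fun i j => ?_)
  refine (dg_conj_apply _ _ i j).trans ?_
  have : (iC q).1 i j = LaurentPolynomial.C (q.1 i j) := rfl
  rw [this]
  by_cases hi : i = o
  · by_cases hj : j = o
    · subst hi; subst hj; simp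
    · subst hi; simp [(hq j hj).1]
  · by_cases hj : j = o
    · subst hj; simp [(hq i hi).2]
    · simp [hi, hj]

end Parabolic

section LocalRing

variable {m : ℕ} {A : Type*} [CommRing A] [IsLocalRing A]

lemma iC_mem_EP (g : SL m A) : iC g ∈ EP m A := by
  rw [← iP_C]; exact iP_mem_EP (map_mem _ (mem_of_isLocalRing g))

lemma iC_mem_EM (g : SL m A) : iC g ∈ EM m A := by
  rw [← iM_C]; exact iM_mem_EM (map_mem _ (mem_of_isLocalRing g))

/-- The congruence subgroup of the maximal ideal. -/
noncomputable def cong (m : ℕ) (A : Type*) [CommRing A] [IsLocalRing A] : Subgroup (LGL m A) :=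
  (rho (IsLocalRing.residue A)).ker

lemma cong_conj {x : LGL m A} (hx : x ∈ cong m A) (y : LGL m A) : y * x * y⁻¹ ∈ cong m A :=
  (MonoidHom.normal_ker _).conj_mem x hx y

lemma iC_mem_cong {g : SL m A} : iC g ∈ cong m A ↔ mp (IsLocalRing.residue A) g = 1 := by
  rw [cong, MonoidHom.mem_ker, rho_iC, ← iP_C, ← map_one iP, iP_injective.eq_iff,
    ← map_one (mp Polynomial.C), (map_injective Polynomial.C_injective).eq_iff]

lemma ev0_mem_cong_of_iP {g : SL m A[X]} (h : iP g ∈ cong m A) : iC (mp (ev0 A) g) ∈ cong m A := by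
  rw [cong, MonoidHom.mem_ker, rho_iP, ← map_one iP, iP_injective.eq_iff] at h
  rw [iC_mem_cong, ← mp_map_ev0, h, map_one]

lemma ev0_mem_cong_of_iM {g : SL m A[X]} (h : iM g ∈ cong m A) : iC (mp (ev0 A) g) ∈ cong m A := by
  rw [cong, MonoidHom.mem_ker, rho_iM, ← map_one iM, iM_injective.eq_iff] at h
  rw [iC_mem_cong, ← mp_map_ev0, h, map_one]

lemma split_const (o : Fin m) {γ : SL m A} (h : iC γ ∈ cong m A) :
    ∃ p n : SL m A, γ = p * n ∧ (iC p ∈ stab (EP m A) (tau o) ∧ iC p ∈ cong m A) ∧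
      (iC n ∈ stab (EM m A) (tau o) ∧ iC n ∈ cong m A) := by
  obtain ⟨r, u, q, e, hr, hu, hq⟩ := gauss o γ (iC_mem_cong.1 h)
  have hu' : iC (colSL o u) ∈ cong m A := by
    rw [iC_mem_cong, map_colSL, ← colSL_zero o]
    refine ext_val (Matrix.ext fun i j => (coe_colSL ..).trans (Eq.trans ?_ (coe_colSL ..).symm))
    by_cases hi : i = o
    · simp [hi]
    · rw [hu i hi]; rfl
  refine ⟨rowSL o r * q, colSL o u, e, ⟨?_, ?_⟩, iC_colSL_mem _ _, hu'⟩
  · rw [map_mul]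
    refine mul_mem (iC_rowSL_mem _ _) (mem_stab.2 ⟨iC_mem_EP _, ?_⟩)
    rw [tau_conj_iC o hq]; exact iC_mem_EP _
  · have : rowSL o r * q = γ * (colSL o u)⁻¹ := by rw [e]; group
    rw [this, map_mul, map_inv]
    exact mul_mem h (inv_mem hu')

lemma split_EP (hm : 3 ≤ m) (o : Fin m) {x : LGL m A} (hx : x ∈ EP m A) (hx' : x ∈ cong m A) :
    ∃ p, ∃ n : SL m A, x = p * iC n ∧ (p ∈ stab (EP m A) (tau o) ∧ p ∈ cong m A) ∧
      (iC n ∈ stab (EM m A) (tau o) ∧ iC n ∈ cong m A) := by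
  obtain ⟨e, he, rfl⟩ := hx
  have hγ := ev0_mem_cong_of_iP hx'
  obtain ⟨p, n, hpn, hp, hn⟩ := split_const o hγ
  have hb : e * (mp Polynomial.C (mp (ev0 A) e))⁻¹ ∈ kerE m A := by
    refine mem_kerE (mul_mem he (inv_mem (map_mem _ (map_mem _ he)))) ?_
    rw [map_mul, map_inv, mp_ev0_C, mul_inv_cancel]
  have h1 := iP_colPar_mem (kerE_le_colPar hm o hb)
  have h2 : iP (e * (mp Polynomial.C (mp (ev0 A) e))⁻¹) ∈ cong m A := by
    rw [map_mul, map_inv, iP_C]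
    exact mul_mem hx' (inv_mem hγ)
  refine ⟨_, n, ?_, ⟨mul_mem h1 hp.1, mul_mem h2 hp.2⟩, hn⟩
  rw [mul_assoc, ← map_mul iC, ← hpn, map_mul, map_inv, iP_C, inv_mul_cancel_right]

lemma split_EM (hm : 3 ≤ m) (o : Fin m) {x : LGL m A} (hx : x ∈ EM m A) (hx' : x ∈ cong m A) :
    ∃ p : SL m A, ∃ n, x = iC p * n ∧ (iC p ∈ stab (EP m A) (tau o) ∧ iC p ∈ cong m A) ∧
      (n ∈ stab (EM m A) (tau o) ∧ n ∈ cong m A) := by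
  obtain ⟨e, he, rfl⟩ := hx
  have hγ := ev0_mem_cong_of_iM hx'
  obtain ⟨p, n, hpn, hp, hn⟩ := split_const o hγ
  have hb : (mp Polynomial.C (mp (ev0 A) e))⁻¹ * e ∈ kerE m A := by
    refine mem_kerE (mul_mem (inv_mem (map_mem _ (map_mem _ he))) he) ?_
    rw [map_mul, map_inv, mp_ev0_C, inv_mul_cancel]
  have h1 := iM_rowPar_mem (kerE_le_rowPar hm o hb)
  have h2 : iM ((mp Polynomial.C (mp (ev0 A) e))⁻¹ * e) ∈ cong m A := by
    rw [map_mul, map_inv, iM_C]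
    exact mul_mem (inv_mem hγ) hx'
  refine ⟨p, _, ?_, hp, ⟨mul_mem hn.1 h1, mul_mem hn.2 h2⟩⟩
  rw [← mul_assoc, ← map_mul iC, ← hpn, map_mul, map_inv, iM_C, mul_inv_cancel_left]

/-- Products of an element of `E_m(A[T])` and an element of `E_m(A[T⁻¹])`, both congruent
to the identity. -/
noncomputable def bigCell (m : ℕ) (A : Type*) [CommRing A] [IsLocalRing A] : Set (LGL m A) :=
  {x | ∃ k l, (k ∈ EP m A ∧ k ∈ cong m A) ∧ (l ∈ EM m A ∧ l ∈ cong m A) ∧ x = k * l}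

/-- The elements which conjugate `bigCell` into itself. -/
noncomputable def bigCellStab (m : ℕ) (A : Type*) [CommRing A] [IsLocalRing A] : Submonoid (LGL m A) where
  carrier := {y | ∀ h ∈ bigCell m A, y * h * y⁻¹ ∈ bigCell m A}
  one_mem' := by intro h hh; simpa using hh
  mul_mem' := by
    intro y z hy hz h hh
    have := hy _ (hz h hh)
    rwa [show y * z * h * (y * z)⁻¹ = y * (z * h * z⁻¹) * y⁻¹ by group]

lemma tau_mem_bigCellStab (hm : 3 ≤ m) (o : Fin m) : tau o ∈ bigCellStab m A := by
  rintro _ ⟨x, y, hx, hy, rfl⟩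
  obtain ⟨p, u, rfl, hp, hu⟩ := split_EP hm o hx.1 hx.2
  obtain ⟨r, n, rfl, hr, hn⟩ := split_EM hm o hy.1 hy.2
  have hc : iC (u * r) ∈ cong m A := by rw [map_mul]; exact mul_mem hu.2 hr.2
  obtain ⟨p', n', e, hp', hn'⟩ := split_const o hc
  refine ⟨tau o * (p * iC p') * (tau o)⁻¹, tau o * (iC n' * n) * (tau o)⁻¹,
    ⟨(mem_stab.1 (mul_mem hp.1 hp'.1)).2, cong_conj (mul_mem hp.2 hp'.2) _⟩,
    ⟨(mem_stab.1 (mul_mem hn'.1 hn.1)).2, cong_conj (mul_mem hn'.2 hn.2) _⟩, ?_⟩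
  have h1 : p * iC u * (iC r * n) = p * iC p' * (iC n' * n) := by
    rw [mul_assoc, ← mul_assoc (iC u), ← map_mul iC, e, map_mul]
    simp only [mul_assoc]
  rw [h1]
  group

lemma iC_mem_bigCellStab (c : SL m A) : iC c ∈ bigCellStab m A := by
  rintro _ ⟨x, y, hx, hy, rfl⟩
  refine ⟨iC c * x * (iC c)⁻¹, iC c * y * (iC c)⁻¹,
    ⟨mul_mem (mul_mem (iC_mem_EP _) hx.1) (inv_mem (iC_mem_EP _)), cong_conj hx.2 _⟩,
    ⟨mul_mem (mul_mem (iC_mem_EM _) hy.1) (inv_mem (iC_mem_EM _)), cong_conj hy.2 _⟩, ?_⟩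
  group

lemma dg_mem_bigCellStab (hm : 3 ≤ m) (μ : Fin m → ℤ) : dg μ ∈ bigCellStab m A :=
  dg_mem_of_generators (bigCellStab m A) (fun c => by intro h hh; rwa [dg_const_central])
    (fun o => tau_mem_bigCellStab hm o) μ

/-- The group of elements normalizing `bigCell`. -/
noncomputable def bigCellNorm (m : ℕ) (A : Type*) [CommRing A] [IsLocalRing A] : Subgroup (LGL m A) where
  carrier := {y | y ∈ bigCellStab m A ∧ y⁻¹ ∈ bigCellStab m A}
  one_mem' := by simp
  mul_mem' := by
    rintro y z ⟨hy, hy'⟩ ⟨hz, hz'⟩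
    exact ⟨mul_mem hy hz, by rw [_root_.mul_inv_rev]; exact mul_mem hz' hy'⟩
  inv_mem' := by rintro y ⟨hy, hy'⟩; exact ⟨hy', by rwa [inv_inv]⟩

lemma dg_mem_bigCellNorm (hm : 3 ≤ m) (μ : Fin m → ℤ) : dg μ ∈ bigCellNorm m A :=
  ⟨dg_mem_bigCellStab hm μ, by rw [← dg_neg]; exact dg_mem_bigCellStab hm _⟩

lemma iC_mem_bigCellNorm (c : SL m A) : iC c ∈ bigCellNorm m A :=
  ⟨iC_mem_bigCellStab c, by rw [← map_inv]; exact iC_mem_bigCellStab _⟩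

lemma toG_mem_bigCellNorm (hm : 3 ≤ m) {e : SL m A[T;T⁻¹]} (he : e ∈ ElemSubgroup m A[T;T⁻¹]) :
    toG e ∈ bigCellNorm m A :=
  toG_mem_of_generators (bigCellNorm m A).toSubmonoid iC_mem_bigCellNorm
    (dg_mem_bigCellNorm hm) he

lemma EP_le_bigCellNorm (hm : 3 ≤ m) : EP m A ≤ bigCellNorm m A := by
  rintro _ ⟨e, he, rfl⟩
  exact toG_mem_bigCellNorm hm (map_mem _ he)

/-- The normal closure of the constant matrices congruent to the identity. -/
noncomputable def congN (m : ℕ) (A : Type*) [CommRing A] [IsLocalRing A] : Subgroup (LGL m A) :=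
  Subgroup.closure {x | ∃ y ∈ bigCellNorm m A, ∃ c : SL m A, iC c ∈ cong m A ∧
    x = y * iC c * y⁻¹}

lemma congN_conj {x y : LGL m A} (hy : y ∈ bigCellNorm m A) (hx : x ∈ congN m A) :
    y * x * y⁻¹ ∈ congN m A := by
  refine conj_mem_of_closure ?_ hx
  rintro _ ⟨z, hz, c, hc, rfl⟩
  exact Subgroup.subset_closure ⟨y * z, mul_mem hy hz, c, hc, by group⟩

lemma iC_mem_congN {c : SL m A} (hc : iC c ∈ cong m A) : iC c ∈ congN m A :=
  Subgroup.subset_closure ⟨1, one_mem _, c, hc, by group⟩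

lemma congN_le_cong : congN m A ≤ cong m A := by
  refine (Subgroup.closure_le _).2 ?_
  rintro _ ⟨y, -, c, hc, rfl⟩
  exact cong_conj hc y

lemma mul_mem_bigCell {x : LGL m A} (hx : x ∈ congN m A) :
    ∀ h ∈ bigCell m A, x * h ∈ bigCell m A ∧ x⁻¹ * h ∈ bigCell m A := by
  have gen : ∀ y ∈ bigCellNorm m A, ∀ c : SL m A, iC c ∈ cong m A → ∀ h ∈ bigCell m A,
      y * iC c * y⁻¹ * h ∈ bigCell m A := by
    intro y hy c hc h hh
    obtain ⟨k, l, hk, hl, e⟩ := hy.2 h hh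
    rw [inv_inv] at e
    have h2 : iC c * (y⁻¹ * h * y) ∈ bigCell m A :=
      ⟨iC c * k, l, ⟨mul_mem (iC_mem_EP _) hk.1, mul_mem hc hk.2⟩, hl, by rw [e]; group⟩
    have := hy.1 _ h2
    rwa [show y * (iC c * (y⁻¹ * h * y)) * y⁻¹ = y * iC c * y⁻¹ * h by group] at this
  induction hx using Subgroup.closure_induction with
  | mem x hx =>
    obtain ⟨y, hy, c, hc, rfl⟩ := hx
    intro h hh
    refine ⟨gen y hy c hc h hh, ?_⟩
    have := gen y hy c⁻¹ (by rw [map_inv]; exact inv_mem hc) h hh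
    rwa [map_inv, show y * (iC c)⁻¹ * y⁻¹ = (y * iC c * y⁻¹)⁻¹ by group] at this
  | one => intro h hh; simpa using hh
  | mul x y _ _ hx hy =>
    intro h hh
    refine ⟨by rw [mul_assoc]; exact (hx _ (hy h hh).1).1, ?_⟩
    rw [_root_.mul_inv_rev, mul_assoc]; exact (hy _ (hx h hh).2).2
  | inv x _ hx => intro h hh; exact ⟨(hx h hh).2, by rw [inv_inv]; exact (hx h hh).1⟩

lemma mem_bigCell {x : LGL m A} (hx : x ∈ congN m A) : x ∈ bigCell m A := by
  have := (mul_mem_bigCell hx 1 ⟨1, 1, ⟨one_mem _, one_mem _⟩, ⟨one_mem _, one_mem _⟩,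
    (mul_one 1).symm⟩).1
  rwa [mul_one] at this

end LocalRing

section LocalRing

variable {m : ℕ} {A : Type*} [CommRing A]

/-- Moving `tau o` past a constant matrix. -/
lemma tau_mul_iC (o k : Fin m) {δ : SL m A} {v : A} (hδ : ∀ a, a ≠ o → δ.1 a k = 0)
    (hv : v * δ.1 o k = 1) :
    tau o * iC δ = iC δ * iP (rowSL k fun l => (X - 1) * Polynomial.C (v * δ.1 o l)) * tau k := by
  refine Units.ext (Matrix.ext fun a b => ?_)
  have hC : ∀ i j, (iC δ).1 i j = LaurentPolynomial.C (δ.1 i j) := fun i j => rfl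
  rw [← iP_C, ← map_mul, tau, tau, dg_mul_apply, mul_dg_apply, iP_C, hC]
  have h1 : (iP (mp Polynomial.C δ * rowSL k fun l => (X - 1) * Polynomial.C (v * δ.1 o l))).1 a b
      = toLaurent ((mp Polynomial.C δ *
        rowSL k fun l => (X - 1) * Polynomial.C (v * δ.1 o l)).1 a b) := rfl
  rw [h1, mul_rowSL_apply, mp_apply, mp_apply]
  by_cases ha : a = o
  · subst ha
    by_cases hb : b = k
    · subst hb
      simp only [ne_eq, not_true_eq_false, if_false, add_zero, toLaurent_C, Pi.single_eq_same]
      exact mul_comm _ _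
    · have h2 : Polynomial.C (δ.1 a k) * ((X - 1) * Polynomial.C (v * δ.1 a b)) =
          (X - 1) * Polynomial.C (δ.1 a b) := by
        rw [show (X - 1) * Polynomial.C (δ.1 a b) =
          (X - 1) * Polynomial.C ((v * δ.1 a k) * δ.1 a b) by rw [hv, one_mul]]
        simp only [Polynomial.C_mul]
        ring
      rw [if_pos hb, h2]
      simp [hb]
      ring
  · by_cases hb : b = k
    · subst hb
      simp [hδ a ha]
    · simp [hδ a ha, ha, hb]

lemma dg_mul_iC_colSL (k : Fin m) (μ : Fin m → ℤ) (c : Fin m → A)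
    (h : ∀ i, c i ≠ 0 → μ k ≤ μ i) : ∃ q ∈ EM m A, iC (colSL k c) * dg μ = dg μ * q := by
  refine ⟨(dg μ)⁻¹ * iC (colSL k c) * dg μ, ?_, by group⟩
  refine colSL_mem (Q := (EM m A).comap (((MulAut.conj (dg μ)⁻¹).toMonoidHom).comp iC)) k c
    fun i hi => ?_
  change (dg μ)⁻¹ * iC (el i k hi (c i)) * ((dg μ)⁻¹)⁻¹ ∈ EM m A
  rw [← dg_neg, iC_el, dg_conj_el]
  by_cases hc : c i = 0
  · rw [hc, map_zero, mul_zero, el_zero, map_one]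
    exact one_mem _
  · have h1 : (T ((-μ) i - (-μ) k) * LaurentPolynomial.C (c i) : A[T;T⁻¹]) =
        toLaurentInv A (X ^ (μ i - μ k).toNat * Polynomial.C (c i)) := by
      rw [map_mul, map_pow, toLaurentInv_X, toLaurentInv_C, T_pow,
        Int.toNat_of_nonneg (sub_nonneg.2 (h i hc))]
      congr 2
      simp only [Pi.neg_apply]
      ring
    rw [h1, ← iM_el]
    exact iM_mem_EM (el_mem _ _ _ _)

variable [IsLocalRing A]

/-- The set of products `ν p (dg μ) q`. -/
noncomputable def birk (m : ℕ) (A : Type*) [CommRing A] [IsLocalRing A] : Set (LGL m A) :=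
  {x | ∃ ν ∈ congN m A, ∃ p ∈ EP m A, ∃ μ : Fin m → ℤ, ∃ q ∈ EM m A, x = ν * p * dg μ * q}

/-- The elements which multiply `birk` into itself. -/
noncomputable def birkStab (m : ℕ) (A : Type*) [CommRing A] [IsLocalRing A] : Submonoid (LGL m A) where
  carrier := {y | ∀ x ∈ birk m A, y * x ∈ birk m A}
  one_mem' := by intro h hh; simpa using hh
  mul_mem' := by
    intro y z hy hz h hh
    rw [mul_assoc]
    exact hy _ (hz h hh)

lemma mem_birkStab_of_mem_EP (hm : 3 ≤ m) {y : LGL m A} (hy : y ∈ EP m A) : y ∈ birkStab m A := by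
  rintro _ ⟨ν, hν, p, hp, μ, q, hq, rfl⟩
  exact ⟨_, congN_conj (EP_le_bigCellNorm hm hy) hν, y * p, mul_mem hy hp, μ, q, hq, by group⟩

lemma mem_birkStab_of_mem_congN {y : LGL m A} (hy : y ∈ congN m A) : y ∈ birkStab m A := by
  rintro _ ⟨ν, hν, p, hp, μ, q, hq, rfl⟩
  exact ⟨_, mul_mem hy hν, p, hp, μ, q, hq, by group⟩

lemma dg_const_mem_birkStab (hm : 3 ≤ m) (c : ℤ) : dg (fun _ => c) ∈ birkStab m A := by
  rintro _ ⟨ν, hν, p, hp, μ, q, hq, rfl⟩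
  refine ⟨_, congN_conj (dg_mem_bigCellNorm hm fun _ => c) hν, p, hp, (fun _ => c) + μ, q, hq, ?_⟩
  have h := mul_inv_eq_iff_eq_mul.1 (dg_const_central c p)
  rw [dg_add]
  simp only [mul_assoc]
  rw [← mul_assoc p (dg fun _ => c), ← h, mul_assoc, inv_mul_cancel_left]

lemma tau_mem_birkStab (hm : 3 ≤ m) (o : Fin m) : tau o ∈ birkStab m A := by
  rintro _ ⟨ν, hν, p, hp, μ, q, hq, rfl⟩
  obtain ⟨e, he, rfl⟩ := hp
  set γ := mp (ev0 A) e with hγ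
  have hb : e * (mp Polynomial.C γ)⁻¹ ∈ kerE m A := by
    refine mem_kerE (mul_mem he (inv_mem (map_mem _ (map_mem _ he)))) ?_
    rw [map_mul, map_inv, mp_ev0_C, mul_inv_cancel]
  have h1 := (mem_stab.1 (iP_colPar_mem (kerE_le_colPar hm o hb))).2
  set b := iP (e * (mp Polynomial.C γ)⁻¹) with hbd
  have he' : iP e = b * iC γ := by
    rw [hbd, map_mul, map_inv, iP_C, inv_mul_cancel_right]
  obtain ⟨k0, -, hk0⟩ := exists_isUnit_of_sum (s := Finset.univ)
    (f := fun k => γ.1 o k) (g := fun k => (γ⁻¹).1 k o) (by rw [sum_mul_inv, if_pos rfl])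
  classical
  obtain ⟨k, hk, hmin⟩ := Finset.exists_min_image
    (Finset.univ.filter fun k => IsUnit ((γ⁻¹).1 k o)) μ ⟨k0, by simpa using hk0⟩
  obtain ⟨w, hw⟩ : IsUnit ((γ⁻¹).1 k o) := by simpa using hk
  set v : Fin m → A := fun i => (γ⁻¹).1 i o with hv
  set yI : Fin m → A := fun i => if IsUnit (v i) then 0 else v i * (↑w⁻¹ : A) with hyI
  set yU : Fin m → A := fun i => if IsUnit (v i) then v i * (↑w⁻¹ : A) else 0 with hyU
  set y := colSL k (fun i => v i * (↑w⁻¹ : A)) with hy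
  have hyIU : y = colSL k yI * colSL k yU := by
    rw [hy, ← colSL_add]
    congr 1
    ext i
    by_cases hi : IsUnit (v i) <;> simp [hyI, hyU, hi]
  set δ := γ * y with hδ
  have hδk : ∀ a, δ.1 a k = if a = o then (↑w⁻¹ : A) else 0 := by
    intro a
    have hyk : ∀ i, y.1 i k = v i * (↑w⁻¹ : A) := by
      intro i
      rw [hy, coe_colSL]
      by_cases hi : i = k
      · subst hi; simp [show v i = w from hw.symm]
      · simp [hi]
    rw [hδ, mul_apply']
    simp only [hyk, ← mul_assoc, ← Finset.sum_mul]
    rw [hv, sum_mul_inv, ite_mul, one_mul, zero_mul]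
  have hδo := tau_mul_iC o k (δ := δ) (v := w) (fun a ha => by rw [hδk, if_neg ha])
    (by rw [hδk, if_pos rfl]; simp)
  set z := iP (rowSL k fun l => (X - 1) * Polynomial.C ((w : A) * δ.1 o l)) with hz
  have hzm : z ∈ EP m A := iP_mem_EP (rowSL_mem _ _ fun i hi => el_mem _ _ _ _)
  have hI : iC (colSL k yI)⁻¹ ∈ cong m A := by
    rw [iC_mem_cong, ← colSL_neg, map_colSL, ← colSL_zero k]
    congr 1
    ext i
    by_cases hi : IsUnit (v i)
    · simp [hyI, hi]
    · have : IsLocalRing.residue A (v i) = 0 := by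
        by_contra h
        exact hi ((IsLocalRing.residue_ne_zero_iff_isUnit _).1 h)
      simp [hyI, hi, this]
  obtain ⟨q', hq', hqe⟩ := dg_mul_iC_colSL k μ (-yU) (fun i hi => by
    refine hmin i ?_
    simp only [Finset.mem_filter, Finset.mem_univ, true_and]
    by_contra h
    exact hi (by simp only [Pi.neg_apply, hyU]; rw [if_neg h, neg_zero]))
  have htau : ∀ μ : Fin m → ℤ, tau k * dg μ = dg (A := A) (Pi.single k 1 + μ) := fun μ => by
    rw [dg_add, tau]
  have key : tau o * (ν * iP e * dg μ * q) = (tau o * ν * (tau o)⁻¹) *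
      ((tau o * b * (tau o)⁻¹) * iC δ * z * ((tau k * iC (colSL k yI)⁻¹ * (tau k)⁻¹) *
        dg (Pi.single k 1 + μ) * (q' * q))) := by
    have hyi : iC y⁻¹ = iC (colSL k yI)⁻¹ * iC (colSL k (-yU)) := by
      rw [hyIU, _root_.mul_inv_rev, ← colSL_neg, ← colSL_neg, ← colSL_add, add_comm,
        colSL_add, map_mul]
    have hδ' : tau o * iC γ = iC δ * z * tau k * iC y⁻¹ := by
      rw [← hδo, mul_assoc, ← map_mul, hδ, mul_inv_cancel_right]
    calc tau o * (ν * iP e * dg μ * q)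
        = (tau o * ν * (tau o)⁻¹) * (tau o * b * (tau o)⁻¹) * (tau o * iC γ) * dg μ * q := by
          rw [he']; group
      _ = (tau o * ν * (tau o)⁻¹) * (tau o * b * (tau o)⁻¹) * iC δ * z * tau k *
            iC (colSL k yI)⁻¹ * (iC (colSL k (-yU)) * dg μ) * q := by
          rw [hδ', hyi]; group
      _ = _ := by rw [hqe, ← htau]; group
  rw [key]
  refine mem_birkStab_of_mem_congN (congN_conj (dg_mem_bigCellNorm hm (Pi.single o 1)) hν) _ ?_
  refine mem_birkStab_of_mem_EP hm (mul_mem (mul_mem h1 (iC_mem_EP _)) hzm) _ ?_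
  refine ⟨_, congN_conj (dg_mem_bigCellNorm hm (Pi.single k 1)) (iC_mem_congN hI), 1, one_mem _,
    Pi.single k 1 + μ, _, mul_mem hq' hq, ?_⟩
  simp only [mul_one, mul_assoc, tau]

lemma toG_mem_birk (hm : 3 ≤ m) {e : SL m A[T;T⁻¹]} (he : e ∈ ElemSubgroup m A[T;T⁻¹]) :
    toG e ∈ birk m A := by
  have h := toG_mem_of_generators (birkStab m A)
    (fun g => mem_birkStab_of_mem_EP hm (iC_mem_EP g))
    (dg_mem_of_generators (birkStab m A) (dg_const_mem_birkStab hm) (tau_mem_birkStab hm)) he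
  have := h 1 ⟨1, one_mem _, 1, one_mem _, 0, 1, one_mem _, by rw [dg_zero]; simp⟩
  rwa [mul_one] at this

/-- If a polynomial matrix in `T` is a monomial diagonal matrix times a polynomial matrix in
`T⁻¹`, both of determinant one, then the diagonal matrix is trivial. -/
lemma eq_zero_of_iP_eq {B : Type*} [CommRing B] [Nontrivial B] (P M : SL m B[X])
    (μ : Fin m → ℤ) (h : iP P = dg μ * iM M) : μ = 0 := by
  have hnn : ∀ i, 0 ≤ μ i := by
    intro i
    by_contra hi
    have hrow : ∀ j, P.1 i j = 0 := by
      intro j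
      have h1 := congrArg (fun g : LGL m B => g.1 i j) h
      rw [dg_mul_apply] at h1
      have h2 : toLaurent (P.1 i j) = T (μ i) * toLaurentInv B (M.1 i j) := h1
      ext n
      rw [← toLaurent_coeff, h2, T, AddMonoidAlgebra.coeff_single_mul_apply, one_mul,
        toLaurentInv_coeff_pos _ (by omega), Polynomial.coeff_zero]
    have := P.2
    rw [Matrix.det_eq_zero_of_row_eq_zero i hrow] at this
    exact zero_ne_one this
  have hdet : (∑ i, μ i) = 0 := by
    have h1 := congrArg (fun g : LGL m B => g.1.det) h
    have h2 : (iP P).1.det = 1 := (mp (toLaurent : B[X] →+* B[T;T⁻¹]) P).2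
    have h3 : (iM M).1.det = 1 := (mp (toLaurentInv B) M).2
    have h4 : (dg μ : LGL m B).1.det = T (∑ i, μ i) := by
      refine Matrix.det_diagonal.trans ?_
      induction (Finset.univ : Finset (Fin m)) using Finset.induction_on with
      | empty => simp
      | insert a s ha ih => rw [Finset.prod_insert ha, Finset.sum_insert ha, T_add, ih]
    rw [h2, Units.val_mul, Matrix.det_mul, h3, mul_one, h4] at h1
    by_contra hne
    have h5 := congrArg (fun p : B[T;T⁻¹] => p.coeff 0) h1
    simp only [← T_zero, T, AddMonoidAlgebra.coeff_single, Finsupp.single_apply] at h5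
    simp [hne] at h5
  ext i
  exact (Finset.sum_eq_zero_iff_of_nonneg fun i _ => hnn i).1 hdet i (Finset.mem_univ i)

lemma mem_of_iP_eq_of_isLocalRing (hm : 3 ≤ m) (g h : SL m A[X]) {e : SL m A[T;T⁻¹]}
    (he : e ∈ ElemSubgroup m A[T;T⁻¹]) (heq : iP g = toG e * iM h) :
    g ∈ ElemSubgroup m A[X] ∧ h ∈ ElemSubgroup m A[X] := by
  obtain ⟨ν, hν, _, ⟨p, hp, rfl⟩, μ, _, ⟨q, hq, rfl⟩, e1⟩ := toG_mem_birk hm he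
  have hμ : μ = 0 := by
    have h1 := congrArg (rho (IsLocalRing.residue A)) heq
    have h2 : rho (IsLocalRing.residue A) ν = 1 := congN_le_cong hν
    rw [e1] at h1
    simp only [map_mul, h2, one_mul, rho_iP, rho_iM, rho_dg] at h1
    refine eq_zero_of_iP_eq (mp (mapRingHom (IsLocalRing.residue A)) (p⁻¹ * g))
      (mp (mapRingHom (IsLocalRing.residue A)) (q * h)) μ ?_
    rw [map_mul, map_mul, map_mul, map_mul, h1, map_inv, map_inv]
    group
  subst hμ
  rw [dg_zero, mul_one] at e1
  obtain ⟨k, l, ⟨⟨k, hk, rfl⟩, -⟩, ⟨⟨l, hl, rfl⟩, -⟩, e2⟩ := mem_bigCell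
    (congN_conj (inv_mem (EP_le_bigCellNorm hm (iP_mem_EP hp))) hν)
  have e3 : iP ((p * k)⁻¹ * g) = iM (l * q * h) := by
    have : ν * iP p = iP p * (iP k * iM l) := by rw [← e2]; group
    rw [map_mul, heq, e1, this]
    simp only [map_mul, map_inv]
    group
  have e4 : (p * k)⁻¹ * g = mp Polynomial.C (mp (ev0 A) ((p * k)⁻¹ * g)) := by
    refine ext_val (Matrix.ext fun i j => ?_)
    have h1 := congrArg (fun g : LGL m A => g.1 i j) e3
    refine (eq_C_of_toLaurent_eq (p := ((p * k)⁻¹ * g).1 i j)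
      (q := (l * q * h).1 i j) h1).trans ?_
    rw [mp_apply, mp_apply, coe_evalRingHom, coeff_zero_eq_eval_zero]
  have e5 : mp Polynomial.C (mp (ev0 A) ((p * k)⁻¹ * g)) ∈ ElemSubgroup m A[X] :=
    map_mem _ (mem_of_isLocalRing _)
  have e6 : l * q * h = mp Polynomial.C (mp (ev0 A) ((p * k)⁻¹ * g)) := by
    apply iM_injective
    rw [← e3, iM_C, ← iP_C, ← e4]
  constructor
  · rw [← e4] at e5
    exact (Subgroup.mul_mem_cancel_left _ (inv_mem (mul_mem hp hk))).1 e5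
  · rw [← e6] at e5
    exact (Subgroup.mul_mem_cancel_left _ (mul_mem hl hq)).1 e5

end LocalRing

section Horrocks

variable {m : ℕ} {R : Type*} [CommRing R]

lemma rho_toG {A B : Type*} [CommRing A] [CommRing B] (f : A →+* B) (g : SL m A[T;T⁻¹]) :
    rho f (toG g) = toG (mp (lmap f) g) :=
  Units.ext (Matrix.ext fun _ _ => rfl)

lemma mul_mp_C_inv_mem (hm : 3 ≤ m) (g : SL m R[X])
    (h : ∀ (I : Ideal R) [I.IsMaximal],
      mp (mapRingHom (algebraMap R (Localization.AtPrime I))) g ∈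
        ElemSubgroup m (Localization.AtPrime I)[X]) :
    g * (mp Polynomial.C (mp (ev0 R) g))⁻¹ ∈ ElemSubgroup m R[X] := by
  refine local_global hm _ ?_ fun I hI => ?_
  · rw [map_mul, map_inv, mp_ev0_C, mul_inv_cancel]
    exact one_mem _
  · rw [map_mul, map_inv, mp_map_C, ← mp_map_ev0]
    exact mul_mem (h I) (inv_mem (map_mem _ (map_mem _ (h I))))

/-- Horrocks' theorem for `SL_m`: a polynomial matrix in `T` which is elementary over the Laurent
polynomials up to a polynomial matrix in `T⁻¹` is elementary. -/
theorem mem_of_iP_eq (hm : 3 ≤ m) (g h : SL m R[X]) (h0 : mp (ev0 R) h ∈ ElemSubgroup m R)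
    {e : SL m R[T;T⁻¹]} (he : e ∈ ElemSubgroup m R[T;T⁻¹]) (heq : iP g = toG e * iM h) :
    g ∈ ElemSubgroup m R[X] := by
  have hloc : ∀ (I : Ideal R) [I.IsMaximal],
      mp (mapRingHom (algebraMap R (Localization.AtPrime I))) g ∈
        ElemSubgroup m (Localization.AtPrime I)[X] ∧
      mp (mapRingHom (algebraMap R (Localization.AtPrime I))) h ∈
        ElemSubgroup m (Localization.AtPrime I)[X] := by
    intro I hI
    refine mem_of_iP_eq_of_isLocalRing hm _ _
      (map_mem (lmap (algebraMap R (Localization.AtPrime I))) he) ?_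
    rw [← rho_iP, heq, map_mul, rho_iM, rho_toG]
  have hh : h ∈ ElemSubgroup m R[X] := local_global hm h h0 fun I _ => (hloc I).2
  have hg := mul_mp_C_inv_mem hm g fun I _ => (hloc I).1
  have heq' : mp toLaurent g = e * mp (toLaurentInv R) h := by
    refine Matrix.SpecialLinearGroup.toGL_injective ?_
    rw [map_mul]
    exact heq
  let ev1 : R[T;T⁻¹] →+* R := LaurentPolynomial.eval₂ (RingHom.id R) 1
  have h1 : mp (ev1.comp toLaurent) g ∈ ElemSubgroup m R := by
    have := mul_mem (map_mem ev1 he) (map_mem ev1 (map_mem (toLaurentInv R) hh))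
    rwa [← (mp ev1).map_mul, ← heq', map_map] at this
  have h2 : mp (ev1.comp toLaurent) (mp Polynomial.C (mp (ev0 R) g)) = mp (ev0 R) g := by
    rw [map_map]
    refine (mp_congr (RingHom.ext fun r => ?_) _).trans (map_id _)
    simp [ev1]
  have h3 : mp (ev0 R) g ∈ ElemSubgroup m R := by
    have := map_mem (ev1.comp toLaurent) hg
    rw [map_mul, map_inv, h2] at this
    exact inv_mem_iff.1 ((Subgroup.mul_mem_cancel_left _ h1).1 this)
  exact (Subgroup.mul_mem_cancel_right _ (inv_mem (map_mem _ h3))).1 hg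

end Horrocks

section MonicInversion

variable {m : ℕ} {R : Type*} [CommRing R]

lemma exists_mp_eq {S S' : Type*} [CommRing S] [CommRing S'] {f : S →+* S'}
    (hf : Function.Injective f) {x : SL m S'} (H : Fin m → Fin m → S)
    (hH : ∀ i j, f (H i j) = x.1 i j) : ∃ h : SL m S, mp f h = x ∧ ∀ i j, h.1 i j = H i j := by
  have h1 : (Matrix.of H).map f = x.1 := Matrix.ext hH
  refine ⟨⟨Matrix.of H, hf ?_⟩, Subtype.ext h1, fun _ _ => rfl⟩
  rw [RingHom.map_det, map_one, RingHom.mapMatrix_apply, h1]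
  exact x.2

lemma exists_toLaurentInv_eq (l : R[T;T⁻¹]) :
    ∃ (n : ℕ) (p : R[X]), toLaurentInv R p = toLaurentInv R (X ^ n) * l := by
  obtain ⟨n, p, h⟩ := exists_T_pow (invert l)
  refine ⟨n, p, ?_⟩
  rw [toLaurentInv_apply, h, map_mul, map_pow, toLaurentInv_X, invert_T, T_pow, mul_comm,
    mul_neg_one]
  congr 1
  exact invert.symm_apply_apply l

lemma isCoprime_X_of_isUnit_coeff_zero {b : R[X]} (hb : IsUnit (b.coeff 0)) : IsCoprime X b := by
  obtain ⟨u, hu⟩ := hb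
  refine ⟨-Polynomial.C (↑u⁻¹ : R) * b.divX, Polynomial.C (↑u⁻¹ : R), ?_⟩
  have h1 := b.divX_mul_X_add
  have h2 : Polynomial.C (↑u⁻¹ : R) * Polynomial.C (b.coeff 0) = 1 := by
    rw [← Polynomial.C_mul, ← hu, Units.inv_mul, Polynomial.C_1]
  linear_combination (-Polynomial.C (↑u⁻¹ : R)) * h1 + h2

lemma mul_toLaurentInv_eq_zero {b : R[X]} (hb : IsUnit (b.coeff 0)) {l : R[T;T⁻¹]}
    (h : l * toLaurentInv R b = 0) : l = 0 := by
  obtain ⟨n, p, hp⟩ := exists_toLaurentInv_eq l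
  have hpb : p * b = 0 := by
    apply toLaurentInv_injective
    rw [map_mul, hp, mul_assoc, h, mul_zero, map_zero]
  have hp0 : p = 0 := by
    have hX : (X : R[X]) ^ p.natDegree.succ ∣ p := by
      refine (isCoprime_X_of_isUnit_coeff_zero hb).pow_left.dvd_of_dvd_mul_right ?_
      rw [hpb]
      exact dvd_zero _
    ext k
    by_cases hk : k < p.natDegree.succ
    · exact X_pow_dvd_iff.1 hX k hk
    · exact coeff_eq_zero_of_natDegree_lt (by omega)
  rw [hp0, map_zero, map_pow, toLaurentInv_X, T_pow] at hp
  exact ((isUnit_T _).mul_right_eq_zero).1 hp.symm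

/-- Inverting a polynomial with invertible leading coefficient is injective on
`SL_m` modulo elementary matrices. -/
theorem mem_of_map_away_mem (hm : 3 ≤ m) (f : R[X]) (hf : IsUnit f.leadingCoeff) (g : SL m R[X])
    (hg : mp (algebraMap R[X] (Localization.Away f)) g ∈ ElemSubgroup m (Localization.Away f)) :
    g ∈ ElemSubgroup m R[X] := by
  set b := f.reverse with hb
  have hb0 : IsUnit (b.coeff 0) := by rwa [hb, coeff_zero_reverse]
  set β := toLaurentInv R b with hβ
  have hβf : toLaurent f = β * T f.natDegree := by
    rw [hβ, toLaurentInv_apply, hb, toLaurent_reverse, map_mul, invert_T, mul_assoc, ← T_add,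
      neg_add_cancel, T_zero, mul_one]
    exact (invert.symm_apply_apply _).symm
  let f₁ : R[T;T⁻¹] →+* Localization.Away β := algebraMap _ _
  have hβu : IsUnit (f₁ β) := IsLocalization.Away.algebraMap_isUnit β
  let f₂ : Localization.Away b →+* Localization.Away β :=
    IsLocalization.Away.lift b (g := f₁.comp (toLaurentInv R)) hβu
  have hf₂ : ∀ p, f₂ (algebraMap R[X] _ p) = f₁ (toLaurentInv R p) :=
    fun p => IsLocalization.Away.lift_eq ..
  have hβ₂ : f₁ β = f₂ (algebraMap R[X] _ b) := (hf₂ b).symm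
  have hfu : IsUnit ((f₁.comp toLaurent) f) := by
    rw [RingHom.comp_apply, hβf, map_mul]
    exact hβu.mul ((isUnit_T _).map f₁)
  let f₃ : Localization.Away f →+* Localization.Away β :=
    IsLocalization.Away.lift f (g := f₁.comp toLaurent) hfu
  have hf₃ : f₃.comp (algebraMap R[X] _) = f₁.comp toLaurent :=
    IsLocalization.Away.lift_comp f hfu
  have hf₁ : ∀ l, f₁ l = 0 → l = 0 := by
    intro l hl
    obtain ⟨⟨_, q, rfl⟩, hq⟩ := (IsLocalization.map_eq_zero_iff (Submonoid.powers β) _ l).1 hl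
    have hb' : IsUnit ((b ^ q).coeff 0) := by
      rw [coeff_zero_eq_eval_zero, eval_pow, ← coeff_zero_eq_eval_zero]
      exact hb0.pow q
    refine mul_toLaurentInv_eq_zero hb' ?_
    rw [map_pow, mul_comm]
    exact hq
  have he := map_mem f₃ hg
  rw [map_map, hf₃, ← map_map] at he
  obtain ⟨e₁, he₁, e₂, he₂, heq⟩ := factor hm (toLaurentInv R)
    (algebraMap R[X] (Localization.Away b)) f₁ f₂ (RingHom.ext fun p => (hf₂ p).symm) X b
    (isCoprime_X_of_isUnit_coeff_zero hb0)
    (fun c => by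
      obtain ⟨q, x, h⟩ := IsLocalization.Away.surj β c
      exact ⟨q, x, by rw [← h, mul_comm]⟩)
    (fun c => by
      obtain ⟨q, x, h⟩ := IsLocalization.Away.surj β c
      obtain ⟨n, p, hp⟩ := exists_toLaurentInv_eq x
      refine ⟨n, IsLocalization.mk' _ p (⟨b ^ q, q, rfl⟩ : Submonoid.powers b), ?_⟩
      refine (hβu.pow q).mul_right_cancel ?_
      have h1 : f₂ (IsLocalization.mk' _ p (⟨b ^ q, q, rfl⟩ : Submonoid.powers b)) * f₁ β ^ q =
          f₁ (toLaurentInv R p) := by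
        rw [hβ₂, ← hf₂, ← map_pow, ← map_mul, ← map_pow]
        congr 1
        exact IsLocalization.mk'_spec _ p (⟨b ^ q, q, rfl⟩ : Submonoid.powers b)
      rw [h1, hp, mul_assoc, h, hf₂, map_mul, map_pow, map_pow])
    he
  have hmat : mp f₁ (e₁⁻¹ * mp toLaurent g) = mp f₂ e₂ := by
    rw [map_mul, map_inv, heq, inv_mul_cancel_left]
  have hglue : ∀ l x, f₁ l = f₂ x → ∃ r, toLaurentInv R r = l ∧ algebraMap R[X] _ r = x := by
    intro l x hlx
    obtain ⟨q, p, hp⟩ := IsLocalization.Away.surj b x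
    obtain ⟨n, p', hp'⟩ := exists_toLaurentInv_eq l
    have h1 : l * β ^ q = toLaurentInv R p := by
      rw [← sub_eq_zero]
      apply hf₁
      rw [map_sub, map_mul, hlx, ← hf₂, ← hp, map_mul, map_pow, map_pow, hβ₂, sub_self]
    have h2 : X ^ n * p = p' * b ^ q := by
      apply toLaurentInv_injective
      rw [map_mul, map_mul, hp', ← h1, map_pow _ b, ← hβ]
      ring
    obtain ⟨r, hr⟩ : b ^ q ∣ p :=
      ((isCoprime_X_of_isUnit_coeff_zero hb0).symm.pow).dvd_of_dvd_mul_left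
        (Dvd.intro_left p' h2.symm)
    refine ⟨r, ?_, ?_⟩
    · rw [← sub_eq_zero]
      apply hf₁
      refine ((hβu.pow q).mul_left_eq_zero).1 ?_
      rw [← map_pow, ← map_mul, sub_mul, h1, hr, map_mul, map_pow, ← hβ, mul_comm, sub_self,
        map_zero]
    · refine ((IsLocalization.Away.algebraMap_isUnit b).pow q).mul_right_cancel ?_
      rw [hp, hr, map_mul, map_pow, mul_comm]
  choose H hH₁ hH₂ using fun i j => hglue _ _ (congrArg (fun x : SL m _ => x.1 i j) hmat)
  obtain ⟨h, hh, hhH⟩ := exists_mp_eq toLaurentInv_injective H hH₁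
  have hh2 : mp (algebraMap R[X] (Localization.Away b)) h = e₂ :=
    ext_val (Matrix.ext fun i j => by rw [mp_apply, hhH]; exact hH₂ i j)
  have hev : IsUnit (ev0 R b) := by
    rwa [coe_evalRingHom, ← coeff_zero_eq_eval_zero]
  have h0 : mp (ev0 R) h ∈ ElemSubgroup m R := by
    have h3 := map_mem (IsLocalization.Away.lift (S := Localization.Away b) b hev) he₂
    rw [← hh2, map_map] at h3
    rwa [IsLocalization.Away.lift_comp] at h3
  refine mem_of_iP_eq hm g h h0 he₁ ?_
  change toG _ = _ * toG (mp (toLaurentInv R) h)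
  rw [hh, ← map_mul, mul_inv_cancel_left]

end MonicInversion

end SLElem

namespace SLElem

open Polynomial

section Nagata

variable {m : ℕ} {R : Type*} [CommRing R]

lemma isUnit_leadingCoeff_sum [Nontrivial R] {ι : Type*} {S : Finset ι} (hS : S.Nonempty)
    {c : ι → R} (hc : ∀ v ∈ S, IsUnit (c v)) {P : ι → R[X]} (hP : ∀ v ∈ S, (P v).Monic)
    (hinj : Set.InjOn (fun v => (P v).natDegree) S) :
    IsUnit (∑ v ∈ S, Polynomial.C (c v) * P v).leadingCoeff := by
  obtain ⟨w, hw, hmax⟩ := Finset.exists_max_image S (fun v => (P v).natDegree) hS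
  have hle : (∑ v ∈ S, Polynomial.C (c v) * P v).natDegree ≤ (P w).natDegree :=
    natDegree_sum_le_of_forall_le _ _ fun v hv => (natDegree_C_mul_le _ _).trans (hmax v hv)
  have hco : (∑ v ∈ S, Polynomial.C (c v) * P v).coeff (P w).natDegree = c w := by
    rw [finsetSum_coeff, Finset.sum_eq_single_of_mem w hw]
    · rw [Polynomial.coeff_C_mul, (hP w hw).coeff_natDegree, mul_one]
    · intro v hv hvw
      rw [Polynomial.coeff_C_mul, coeff_eq_zero_of_natDegree_lt, mul_zero]
      exact lt_of_le_of_ne (hmax v hv) fun h => hvw (hinj hv hw h)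
  have hdeg := le_antisymm hle (le_natDegree_of_ne_zero (by rw [hco]; exact (hc w hw).ne_zero))
  rw [leadingCoeff, hdeg, hco]
  exact hc w hw

lemma exists_weight_injOn {n : ℕ} (S : Finset (Fin (n + 1) →₀ ℕ)) :
    ∃ r : Fin (n + 1) → ℕ, r 0 = 1 ∧ (∀ i, r i ≠ 0) ∧
      Set.InjOn (fun v : Fin (n + 1) →₀ ℕ => ∑ i, r i * v i) S := by
  obtain ⟨b, hb⟩ : ∃ b : ℕ, ∀ v ∈ S, ∀ i, v i < b := by
    refine ⟨(∑ v ∈ S, ∑ i, v i) + 1, fun v hv i => Nat.lt_succ_of_le ?_⟩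
    exact (Finset.single_le_sum (f := fun i => v i) (fun _ _ => Nat.zero_le _)
      (Finset.mem_univ i)).trans
      (Finset.single_le_sum (f := fun v : Fin (n + 1) →₀ ℕ => ∑ i, v i) (fun _ _ => Nat.zero_le _) hv)
  refine ⟨fun i => (b + 2) ^ (i : ℕ), by simp, fun i => by positivity,
    fun v hv w hw h => ?_⟩
  have hlt : ∀ v ∈ S, ∀ l ∈ List.ofFn v, l < b + 2 := by
    intro v hv l hl
    obtain ⟨i, rfl⟩ := (List.mem_ofFn' _ _).1 hl
    have := hb v hv i
    omega
  refine Finsupp.ext (congrFun (List.ofFn_inj.mp ?_))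
  apply Nat.ofDigits_inj_of_len_eq (by omega : 1 < b + 2) (by simp) (hlt v hv) (hlt w hw)
  simpa only [Nat.ofDigits_eq_sum_mapIdx, List.mapIdx_eq_ofFn, List.get_ofFn, List.length_ofFn,
    Fin.val_cast, mul_comm, List.sum_ofFn] using! h

variable {n : ℕ}

/-- The substitution `X₀ ↦ X`, `Xᵢ₊₁ ↦ Xᵢ + X ^ r (i + 1)`. -/
noncomputable def nagata (R : Type*) [CommRing R] (r : Fin (n + 1) → ℕ) :
    MvPolynomial (Fin (n + 1)) R →ₐ[R] (MvPolynomial (Fin n) R)[X] :=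
  MvPolynomial.aeval (Fin.cases X fun i => X ^ r i.succ + Polynomial.C (MvPolynomial.X i))

/-- The inverse of `nagata`. -/
noncomputable def nagataInv (R : Type*) [CommRing R] (r : Fin (n + 1) → ℕ) :
    (MvPolynomial (Fin n) R)[X] →+* MvPolynomial (Fin (n + 1)) R :=
  Polynomial.eval₂RingHom
    (MvPolynomial.aeval (R := R) fun i : Fin n =>
      (MvPolynomial.X i.succ - MvPolynomial.X 0 ^ r i.succ :
        MvPolynomial (Fin (n + 1)) R)).toRingHom (MvPolynomial.X 0)

lemma nagataInv_comp_nagata (r : Fin (n + 1) → ℕ) :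
    (nagataInv R r).comp (nagata R r).toRingHom = RingHom.id _ := by
  refine MvPolynomial.ringHom_ext (fun a => ?_) fun i => ?_
  · simp [nagataInv, nagata, Polynomial.algebraMap_apply]
  · refine Fin.cases ?_ (fun i => ?_) i <;> simp [nagataInv, nagata]

lemma nagata_monomial (r : Fin (n + 1) → ℕ) (v : Fin (n + 1) →₀ ℕ) (c : R) :
    nagata R r (MvPolynomial.monomial v c) = Polynomial.C (MvPolynomial.C c) *
      nagata R r (MvPolynomial.monomial v 1) := by
  conv_lhs => rw [← mul_one c, ← MvPolynomial.C_mul_monomial, map_mul]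
  congr 1
  simp [nagata, Polynomial.algebraMap_apply]

lemma nagata_monomial_monic [Nontrivial R] (r : Fin (n + 1) → ℕ) (hr : r 0 = 1)
    (hr' : ∀ i, r i ≠ 0) (v : Fin (n + 1) →₀ ℕ) :
    (nagata R r (MvPolynomial.monomial v 1)).Monic ∧
      (nagata R r (MvPolynomial.monomial v 1)).natDegree = ∑ i, r i * v i := by
  have h1 : nagata R r (MvPolynomial.monomial v 1) =
      ∏ i, (nagata R r (MvPolynomial.X i)) ^ v i := by
    rw [MvPolynomial.monomial_eq, MvPolynomial.C_1, one_mul, Finsupp.prod_pow, map_prod]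
    simp only [map_pow]
  have h2 : ∀ i, (nagata R r (MvPolynomial.X i)).Monic ∧
      (nagata R r (MvPolynomial.X i)).natDegree = r i := by
    intro i
    refine Fin.cases ?_ (fun i => ?_) i
    · simp [nagata, hr, monic_X]
    · simp [nagata, monic_X_pow_add_C _ (hr' i.succ)]
  have h3 : ∀ i ∈ Finset.univ, ((nagata R r (MvPolynomial.X i)) ^ v i).Monic :=
    fun i _ => (h2 i).1.pow _
  rw [h1]
  refine ⟨monic_prod_of_monic _ _ h3, ?_⟩
  rw [natDegree_prod_of_monic _ _ h3]
  refine Finset.sum_congr rfl fun i _ => ?_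
  rw [(h2 i).1.natDegree_pow, (h2 i).2, mul_comm]

lemma mem_of_isUnit_of_map_mem {S : Type*} [CommRing S] {s : S} (hs : IsUnit s) {g : SL m S}
    (hg : mp (algebraMap S (Localization.Away s)) g ∈ ElemSubgroup m (Localization.Away s)) :
    g ∈ ElemSubgroup m S := by
  have h := map_mem (IsLocalization.Away.lift (S := Localization.Away s) s
    (g := RingHom.id S) hs) hg
  rwa [map_map, IsLocalization.Away.lift_comp, map_id] at h

/-- Inverting a polynomial in several variables whose nonzero coefficients are units is injective
on `SL_m` modulo elementary matrices. -/
theorem mem_of_map_away_sum_mem (hm : 3 ≤ m) {ι : Type*} {S : Finset ι} (hS : S.Nonempty)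
    {c : ι → R} (hc : ∀ v ∈ S, IsUnit (c v)) {e : ι → Fin n →₀ ℕ} (he : Set.InjOn e S)
    (s : MvPolynomial (Fin n) R) (hs : s = ∑ v ∈ S, MvPolynomial.monomial (e v) (c v))
    (g : SL m (MvPolynomial (Fin n) R))
    (hg : mp (algebraMap _ (Localization.Away s)) g ∈ ElemSubgroup m (Localization.Away s)) :
    g ∈ ElemSubgroup m (MvPolynomial (Fin n) R) := by
  cases subsingleton_or_nontrivial R with
  | inl h =>
    have : g = 1 := ext_val (Matrix.ext fun i j => Subsingleton.elim _ _)
    rw [this]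
    exact one_mem _
  | inr h =>
  cases n with
  | zero =>
    obtain ⟨v, hv⟩ := hS
    have hSv : S = {v} := Finset.eq_singleton_iff_unique_mem.2
      ⟨hv, fun w hw => he hw hv (Subsingleton.elim _ _)⟩
    refine mem_of_isUnit_of_map_mem (s := s) ?_ hg
    rw [hs, hSv, Finset.sum_singleton, Subsingleton.elim (e v) 0]
    exact (hc v hv).map MvPolynomial.C
  | succ n =>
    classical
    obtain ⟨r, hr, hr', hinj⟩ := exists_weight_injOn (S.image e)
    have hlead : IsUnit (nagata R r s).leadingCoeff := by
      have hsum : nagata R r s = ∑ v ∈ S, Polynomial.C (MvPolynomial.C (c v)) *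
          nagata R r (MvPolynomial.monomial (e v) 1) := by
        rw [hs, map_sum]
        exact Finset.sum_congr rfl fun v _ => nagata_monomial _ _ _
      rw [hsum]
      refine isUnit_leadingCoeff_sum hS (fun v hv => (hc v hv).map MvPolynomial.C)
        (fun v _ => (nagata_monomial_monic r hr hr' (e v)).1) fun v hv w hw h => ?_
      simp only [(nagata_monomial_monic r hr hr' _).2] at h
      exact he hv hw (hinj (Finset.mem_image_of_mem e hv) (Finset.mem_image_of_mem e hw) h)
    have h1 : mp (nagata R r).toRingHom g ∈ ElemSubgroup m (MvPolynomial (Fin n) R)[X] := by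
      refine mem_of_map_away_mem hm _ hlead _ ?_
      have h2 := map_mem (IsLocalization.Away.lift (S := Localization.Away s) s
        (g := (algebraMap _ (Localization.Away (nagata R r s))).comp (nagata R r).toRingHom)
        (IsLocalization.Away.algebraMap_isUnit _)) hg
      rwa [map_map, IsLocalization.Away.lift_comp, ← map_map] at h2
    have h2 := map_mem (nagataInv R r) h1
    rwa [map_map, nagataInv_comp_nagata, map_id] at h2

/-- Elementary matrices descend along `S → S'` after inverting an element of `S`. -/
lemma map_away_mem_of_injective {S S' : Type*} [CommRing S] [CommRing S'] {φ : S →+* S'}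
    (hφ : Function.Injective φ) {s : S} (hs : IsUnit (φ s)) {g : SL m S}
    (hg : mp φ g ∈ Subgroup.closure {x | ∃ i j, ∃ h : i ≠ j, ∃ c, (∃ b, φ b = φ s * c) ∧
      x = el i j h c}) :
    mp (algebraMap S (Localization.Away s)) g ∈ ElemSubgroup m (Localization.Away s) := by
  let Φ : Localization.Away s →+* S' := IsLocalization.Away.lift s hs
  have hΦ : Φ.comp (algebraMap S _) = φ := IsLocalization.Away.lift_comp s hs
  have hle : Subgroup.closure {x : SL m S' | ∃ i j, ∃ h : i ≠ j, ∃ c, (∃ b, φ b = φ s * c) ∧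
      x = el i j h c} ≤ (ElemSubgroup m (Localization.Away s)).map (mp Φ) := by
    rw [Subgroup.closure_le]
    rintro _ ⟨i, j, h, c, ⟨b, hb⟩, rfl⟩
    refine ⟨el i j h (algebraMap S _ b * IsLocalization.Away.invSelf s), el_mem _ _ _ _, ?_⟩
    rw [map_el]
    congr 1
    refine hs.mul_left_cancel ?_
    have h1 : φ s * Φ (IsLocalization.Away.invSelf s) = 1 := by
      rw [← hΦ, RingHom.comp_apply, ← map_mul, IsLocalization.Away.mul_invSelf, map_one]
    rw [map_mul, ← RingHom.comp_apply, hΦ, hb]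
    linear_combination φ s * c * h1
  obtain ⟨e, he, hge⟩ := hle hg
  have hΦi : Function.Injective Φ := by
    refine (IsLocalization.lift_injective_iff _).2 fun x y => ⟨fun h => ?_, fun h => ?_⟩
    · have := congrArg Φ h
      rwa [← RingHom.comp_apply, ← RingHom.comp_apply, hΦ] at this
    · rw [hφ h]
  rw [← hΦ, ← map_map] at hge
  rwa [← map_injective hΦi hge]

end Nagata

end SLElem

namespace SLElem

section Substitution

variable {n : ℕ}

/-- Ring homomorphisms out of `A[z^{±1}, t]` are determined on `A`, the `zᵢ` and the `tᵢ`. -/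
lemma laurent_mvPolynomial_ext {A R : Type*} [CommRing A] [CommRing R]
    {f g : MvPolynomial (Fin n) (AddMonoidAlgebra A (Fin n →₀ ℤ)) →+* R}
    (hA : ∀ a, f (MvPolynomial.C (AddMonoidAlgebra.single 0 a)) =
      g (MvPolynomial.C (AddMonoidAlgebra.single 0 a)))
    (hz : ∀ i, f (MvPolynomial.C (AddMonoidAlgebra.single (Finsupp.single i 1) 1)) =
      g (MvPolynomial.C (AddMonoidAlgebra.single (Finsupp.single i 1) 1)))
    (ht : ∀ i, f (MvPolynomial.X i) = g (MvPolynomial.X i)) : f = g := by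
  refine MvPolynomial.ringHom_ext' ?_ ht
  refine AddMonoidAlgebra.ringHom_ext' (RingHom.ext hA) ?_
  exact Finsupp.mulHom_ext' fun i => MonoidHom.ext_mint (hz i)

/-- The ring homomorphism out of `A[z^{±1}, t]` given by `f` on `A`, `u` on monomials in the `zᵢ`,
and `x` on the `tᵢ`. -/
noncomputable def evalHom {A R : Type*} [CommRing A] [CommRing R] (f : A →+* R)
    (u : Multiplicative (Fin n →₀ ℤ) →* R) (x : Fin n → R) :
    MvPolynomial (Fin n) (AddMonoidAlgebra A (Fin n →₀ ℤ)) →+* R :=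
  MvPolynomial.eval₂Hom (AddMonoidAlgebra.liftNCRingHom f u fun _ _ => Commute.all _ _) x

lemma evalHom_C_single {A R : Type*} [CommRing A] [CommRing R] (f : A →+* R)
    (u : Multiplicative (Fin n →₀ ℤ) →* R) (x : Fin n → R) (j : Fin n →₀ ℤ) (a : A) :
    evalHom f u x (MvPolynomial.C (AddMonoidAlgebra.single j a)) =
      f a * u (Multiplicative.ofAdd j) := by
  simp [evalHom]

lemma evalHom_X {A R : Type*} [CommRing A] [CommRing R] (f : A →+* R)
    (u : Multiplicative (Fin n →₀ ℤ) →* R) (x : Fin n → R) (i : Fin n) :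
    evalHom f u x (MvPolynomial.X i) = x i := by
  simp [evalHom]

/-- The homomorphism `ℤⁿ → ℤⁿ` multiplying the `i`-th coordinate by `d i`. -/
noncomputable def scale (d : Fin n → ℕ) : (Fin n →₀ ℤ) →+ (Fin n →₀ ℤ) where
  toFun j := Finsupp.equivFunOnFinite.symm fun i => d i * j i
  map_zero' := by ext; simp
  map_add' x y := by ext; simp [mul_add]

lemma scale_apply (d : Fin n → ℕ) (j : Fin n →₀ ℤ) (i : Fin n) : scale d j i = d i * j i := rfl

lemma scale_single (d : Fin n → ℕ) (i : Fin n) (a : ℤ) :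
    scale d (Finsupp.single i a) = Finsupp.single i (d i * a) := by
  ext l
  rw [scale_apply]
  by_cases h : l = i
  · subst h; simp
  · simp [Ne.symm h]

/-- The monomials `j ↦ single (u j) (w j)` as a monoid homomorphism. -/
noncomputable def singleHom {R : Type*} [CommRing R] (u : (Fin n →₀ ℤ) →+ (Fin n →₀ ℤ))
    (w : Multiplicative (Fin n →₀ ℤ) →* R) :
    Multiplicative (Fin n →₀ ℤ) →* AddMonoidAlgebra R (Fin n →₀ ℤ) where
  toFun j := AddMonoidAlgebra.single (u j.toAdd) (w j)
  map_one' := by simp [AddMonoidAlgebra.one_def]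
  map_mul' x y := by simp [AddMonoidAlgebra.single_mul_single]

lemma singleHom_apply {R : Type*} [CommRing R] (u : (Fin n →₀ ℤ) →+ (Fin n →₀ ℤ))
    (w : Multiplicative (Fin n →₀ ℤ) →* R) (j : Fin n →₀ ℤ) :
    singleHom u w (Multiplicative.ofAdd j) =
      AddMonoidAlgebra.single (u j) (w (Multiplicative.ofAdd j)) := rfl

/-- The diagonal substitution `zᵢ ↦ wᵢ tᵢ^{dᵢ}` over coefficients `f : A → R`. -/
noncomputable def diag {A R : Type*} [CommRing A] [CommRing R] (d : Fin n → ℕ) (f : A →+* R)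
    (w : Multiplicative (Fin n →₀ ℤ) →* R) :
    MvPolynomial (Fin n) (AddMonoidAlgebra A (Fin n →₀ ℤ)) →+*
      AddMonoidAlgebra R (Fin n →₀ ℤ) :=
  evalHom (AddMonoidAlgebra.singleZeroRingHom.comp f) (singleHom (scale d) w)
    fun i => AddMonoidAlgebra.single (Finsupp.single i 1) 1

section

variable {A R : Type*} [CommRing A] [CommRing R] (d : Fin n → ℕ) (f : A →+* R)
    (w : Multiplicative (Fin n →₀ ℤ) →* R)

lemma diag_C_single (j : Fin n →₀ ℤ) (a : A) :
    diag d f w (MvPolynomial.C (AddMonoidAlgebra.single j a)) =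
      AddMonoidAlgebra.single (scale d j) (f a * w (Multiplicative.ofAdd j)) := by
  rw [diag, evalHom_C_single, singleHom_apply]
  simp [AddMonoidAlgebra.single_mul_single]

lemma diag_X (i : Fin n) :
    diag d f w (MvPolynomial.X i) = AddMonoidAlgebra.single (Finsupp.single i 1) 1 :=
  evalHom_X _ _ _ _

lemma diag_monomial (v : Fin n →₀ ℕ) (j : Fin n →₀ ℤ) (a : A) :
    diag d f w (MvPolynomial.monomial v (AddMonoidAlgebra.single j a)) =
      AddMonoidAlgebra.single (v.mapRange (Nat.cast : ℕ → ℤ) rfl + scale d j)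
        (f a * w (Multiplicative.ofAdd j)) := by
  have h : ∀ v : Fin n →₀ ℕ, diag d f w (MvPolynomial.monomial v 1) =
      AddMonoidAlgebra.single (v.mapRange (Nat.cast : ℕ → ℤ) rfl) 1 := by
    intro v
    induction v using Finsupp.induction_linear with
    | zero =>
      rw [MvPolynomial.monomial_zero', MvPolynomial.C_1, map_one, Finsupp.mapRange_zero]
      rfl
    | add x y hx hy =>
      rw [← mul_one (1 : AddMonoidAlgebra A (Fin n →₀ ℤ)), ← MvPolynomial.monomial_mul, map_mul,
        hx, hy, AddMonoidAlgebra.single_mul_single, mul_one]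
      congr 1
      ext i
      simp
    | single i a =>
      rw [← MvPolynomial.X_pow_eq_monomial, map_pow, diag_X, AddMonoidAlgebra.single_pow, one_pow]
      congr 1
      ext l
      by_cases hl : i = l
      · subst hl; simp
      · simp [hl]
  rw [← mul_one (AddMonoidAlgebra.single j a), ← MvPolynomial.C_mul_monomial, map_mul, h,
    diag_C_single, AddMonoidAlgebra.single_mul_single, mul_one, add_comm]

lemma diag_eq_map_comp :
    diag d f w = (AddMonoidAlgebra.mapRingHom _
      (AddMonoidAlgebra.liftNCRingHom f w fun _ _ => Commute.all _ _)).comp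
      (diag d AddMonoidAlgebra.singleZeroRingHom (AddMonoidAlgebra.of A _)) := by
  refine laurent_mvPolynomial_ext (fun a => ?_) (fun i => ?_) fun i => ?_
  · rw [RingHom.comp_apply, diag_C_single, diag_C_single]
    simp
  · rw [RingHom.comp_apply, diag_C_single, diag_C_single]
    simp
  · rw [RingHom.comp_apply, diag_X, diag_X]
    simp

lemma diag_of_injective : Function.Injective
    (diag d AddMonoidAlgebra.singleZeroRingHom (AddMonoidAlgebra.of A (Fin n →₀ ℤ))) := by
  let β : AddMonoidAlgebra (AddMonoidAlgebra A (Fin n →₀ ℤ)) (Fin n →₀ ℤ) →+*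
      AddMonoidAlgebra (AddMonoidAlgebra A (Fin n →₀ ℤ)) (Fin n →₀ ℤ) :=
    AddMonoidAlgebra.liftNCRingHom
      (AddMonoidAlgebra.liftNCRingHom
        (AddMonoidAlgebra.singleZeroRingHom.comp AddMonoidAlgebra.singleZeroRingHom)
        (singleHom (-scale d) (AddMonoidAlgebra.of A _)) fun _ _ => Commute.all _ _)
      (AddMonoidAlgebra.of _ _) fun _ _ => Commute.all _ _
  have hβ : β.comp (diag d AddMonoidAlgebra.singleZeroRingHom (AddMonoidAlgebra.of A _)) =
      AddMonoidAlgebra.mapDomainRingHom (AddMonoidAlgebra A (Fin n →₀ ℤ))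
        (Finsupp.mapRange.addMonoidHom (Nat.castAddMonoidHom ℤ)) := by
    have hm : ∀ (v : Fin n →₀ ℕ) (x : AddMonoidAlgebra A (Fin n →₀ ℤ)),
        AddMonoidAlgebra.mapDomainRingHom (AddMonoidAlgebra A (Fin n →₀ ℤ))
          (Finsupp.mapRange.addMonoidHom (Nat.castAddMonoidHom ℤ)) (MvPolynomial.monomial v x) =
        AddMonoidAlgebra.single (v.mapRange (Nat.cast : ℕ → ℤ) rfl) x := fun v x =>
      AddMonoidAlgebra.mapDomain_single
    refine laurent_mvPolynomial_ext (fun a => ?_) (fun i => ?_) fun i => ?_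
    · rw [RingHom.comp_apply, diag_C_single, MvPolynomial.C_apply, hm]
      simp [β]
    · rw [RingHom.comp_apply, diag_C_single, MvPolynomial.C_apply, hm]
      simp [β, singleHom_apply, AddMonoidAlgebra.single_mul_single, AddMonoidAlgebra.one_def]
    · rw [RingHom.comp_apply, diag_X, MvPolynomial.X, hm]
      simp [β]
  refine Function.Injective.of_comp (f := β) ?_
  rw [← RingHom.coe_comp, hβ]
  refine AddMonoidAlgebra.mapDomain_injective fun x y h => ?_
  ext i
  simpa using DFunLike.congr_fun h i

end

section FunctionField

variable (k : Type*) [Field k] (A : Type*) [CommRing A] [Algebra k A] (d : Fin n → ℕ)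
    (Kw : Type*) [Field Kw] [Algebra (MvPolynomial (Fin n) k) Kw]
    [IsFractionRing (MvPolynomial (Fin n) k) Kw]

/-- The Laurent monomials in `k(w₁, …, wₙ)`. -/
noncomputable def wHom : Multiplicative (Fin n →₀ ℤ) →* Kw where
  toFun j := ∏ i, algebraMap (MvPolynomial (Fin n) k) Kw (MvPolynomial.X i) ^ j.toAdd i
  map_one' := by simp
  map_mul' x y := by
    rw [← Finset.prod_mul_distrib]
    refine Finset.prod_congr rfl fun i _ => ?_
    rw [toAdd_mul, Finsupp.add_apply, zpow_add₀]
    exact (map_ne_zero_iff _ (IsFractionRing.injective (MvPolynomial (Fin n) k) Kw)).2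
      (MvPolynomial.X_ne_zero i)

lemma wHom_single (i : Fin n) : wHom k Kw (Multiplicative.ofAdd (Finsupp.single i 1)) =
    algebraMap (MvPolynomial (Fin n) k) Kw (MvPolynomial.X i) := by
  change ∏ l, algebraMap (MvPolynomial (Fin n) k) Kw (MvPolynomial.X l) ^
    (Finsupp.single i (1 : ℤ) l) = _
  rw [Finset.prod_eq_single_of_mem i (Finset.mem_univ i)]
  · simp
  · intro l _ hl
    rw [Finsupp.single_eq_of_ne hl, zpow_zero]

lemma wHom_natCast (v : Fin n →₀ ℕ) :
    wHom k Kw (Multiplicative.ofAdd (v.mapRange (Nat.cast : ℕ → ℤ) rfl)) =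
      algebraMap (MvPolynomial (Fin n) k) Kw (MvPolynomial.monomial v 1) := by
  change ∏ l, algebraMap (MvPolynomial (Fin n) k) Kw (MvPolynomial.X l) ^ ((v l : ℕ) : ℤ) = _
  rw [MvPolynomial.monomial_eq, MvPolynomial.C_1, one_mul, Finsupp.prod_pow, map_prod]
  simp only [map_pow, zpow_natCast]

variable [Algebra k Kw]

/-- The Laurent monomials in `A ⊗ k(w₁, …, wₙ)`. -/
noncomputable def wHomTensor : Multiplicative (Fin n →₀ ℤ) →* A ⊗[k] Kw :=
  (Algebra.TensorProduct.includeRight (R := k) (A := A) (B := Kw) : Kw →* A ⊗[k] Kw).comp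
    (wHom k Kw)

lemma wHomTensor_apply (j : Multiplicative (Fin n →₀ ℤ)) :
    wHomTensor k A Kw j = 1 ⊗ₜ wHom k Kw j := rfl

/-- The exponent `(N, …, N)`. -/
noncomputable def constExp (n N : ℕ) : Fin n →₀ ℤ :=
  Finsupp.equivFunOnFinite.symm fun _ => (N : ℤ)

/-- `t₁^N ⋯ tₙ^N f(w)` as an element of `A ⊗ k(w)[t^{±1}]`. -/
noncomputable def denom (A : Type*) [CommRing A] [Algebra k A] (N : ℕ)
    (f : MvPolynomial (Fin n) k) : AddMonoidAlgebra (A ⊗[k] Kw) (Fin n →₀ ℤ) :=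
  AddMonoidAlgebra.single (constExp n N) (1 ⊗ₜ[k] algebraMap (MvPolynomial (Fin n) k) Kw f)

lemma isUnit_denom (N : ℕ) {f : MvPolynomial (Fin n) k} (hf : f ≠ 0) :
    IsUnit (denom k Kw A N f) := by
  have hf1 : algebraMap (MvPolynomial (Fin n) k) Kw f ≠ 0 :=
    (map_ne_zero_iff _ (IsFractionRing.injective (MvPolynomial (Fin n) k) Kw)).2 hf
  refine IsUnit.of_mul_eq_one (AddMonoidAlgebra.single (-constExp n N)
    (1 ⊗ₜ[k] (algebraMap (MvPolynomial (Fin n) k) Kw f)⁻¹)) ?_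
  rw [denom, AddMonoidAlgebra.single_mul_single, Algebra.TensorProduct.tmul_mul_tmul,
    mul_inv_cancel₀ hf1, one_mul, add_neg_cancel]
  rfl

/-- The substitution `zᵢ ↦ wᵢ tᵢ^{dᵢ}`. -/
noncomputable def diagHom : MvPolynomial (Fin n) (AddMonoidAlgebra A (Fin n →₀ ℤ)) →+*
    AddMonoidAlgebra (A ⊗[k] Kw) (Fin n →₀ ℤ) :=
  diag d Algebra.TensorProduct.includeLeftRingHom (wHomTensor k A Kw)

lemma diagHom_monomial (v : Fin n →₀ ℕ) (j : Fin n →₀ ℤ) (a : A) :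
    diagHom k A d Kw (MvPolynomial.monomial v (AddMonoidAlgebra.single j a)) =
      AddMonoidAlgebra.single (v.mapRange (Nat.cast : ℕ → ℤ) rfl + scale d j)
        (a ⊗ₜ wHom k Kw (Multiplicative.ofAdd j)) := by
  rw [diagHom, diag_monomial, wHomTensor_apply]
  simp

variable [IsScalarTower k (MvPolynomial (Fin n) k) Kw]

lemma algebraMap_monomial (v : Fin n →₀ ℕ) (a : k) :
    algebraMap (MvPolynomial (Fin n) k) Kw (MvPolynomial.monomial v a) =
      a • wHom k Kw (Multiplicative.ofAdd (v.mapRange (Nat.cast : ℕ → ℤ) rfl)) := by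
  rw [wHom_natCast, ← algebraMap_smul (MvPolynomial (Fin n) k) a, Algebra.smul_def, ← map_mul,
    MvPolynomial.algebraMap_eq, MvPolynomial.C_mul_monomial, mul_one]

lemma wHom_linearIndependent :
    LinearIndependent k fun j : Fin n →₀ ℤ => wHom k Kw (Multiplicative.ofAdd j) := by
  rw [linearIndependent_iff']
  intro s g hg
  let J : Fin n →₀ ℕ := Finsupp.equivFunOnFinite.symm fun i => ∑ j ∈ s, (j i).natAbs
  have hJ : ∀ j ∈ s, ∀ i, 0 ≤ j i + (J i : ℤ) := by
    intro j hj i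
    have h : (j i).natAbs ≤ J i :=
      Finset.single_le_sum (f := fun j : Fin n →₀ ℤ => (j i).natAbs) (fun _ _ => Nat.zero_le _) hj
    omega
  let e : (Fin n →₀ ℤ) → Fin n →₀ ℕ := fun j =>
    Finsupp.equivFunOnFinite.symm fun i => (j i + (J i : ℤ)).toNat
  have he : ∀ j ∈ s, (e j).mapRange (Nat.cast : ℕ → ℤ) rfl =
      j + J.mapRange (Nat.cast : ℕ → ℤ) rfl := by
    intro j hj
    ext i
    exact Int.toNat_of_nonneg (hJ j hj i)
  have hinj : Set.InjOn e s := by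
    intro x hx y hy h
    have := he x hx
    rw [h, he y hy] at this
    exact (add_right_cancel this).symm
  have h0 : ∑ j ∈ s, MvPolynomial.monomial (e j) (g j) = 0 := by
    refine IsFractionRing.injective (MvPolynomial (Fin n) k) Kw ?_
    rw [map_zero, map_sum]
    calc _ = ∑ j ∈ s, (g j • wHom k Kw (Multiplicative.ofAdd j)) *
          wHom k Kw (Multiplicative.ofAdd (J.mapRange (Nat.cast : ℕ → ℤ) rfl)) := by
            refine Finset.sum_congr rfl fun j hj => ?_
            rw [algebraMap_monomial, he j hj, ofAdd_add, map_mul, smul_mul_assoc]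
      _ = 0 := by rw [← Finset.sum_mul, hg, zero_mul]
  intro j hj
  have h1 := congrArg (MvPolynomial.coeff (e j)) h0
  rw [MvPolynomial.coeff_sum, Finset.sum_eq_single_of_mem j hj, MvPolynomial.coeff_monomial,
    if_pos rfl, MvPolynomial.coeff_zero] at h1
  · exact h1
  · intro l hl hlj
    rw [MvPolynomial.coeff_monomial, if_neg fun h => hlj (hinj hl hj h)]

lemma lift_wHomTensor_injective : Function.Injective
    (AddMonoidAlgebra.liftNCRingHom (Algebra.TensorProduct.includeLeftRingHom (R := k))
      (wHomTensor (n := n) k A Kw) fun _ _ => Commute.all _ _) := by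
  have h1 := Module.Flat.lTensor_preserves_injective_linearMap (M := A) _
    (wHom_linearIndependent (n := n) k Kw)
  have h2 := h1.comp (TensorProduct.finsuppScalarRight k k A (Fin n →₀ ℤ)).symm.injective
  have h3 := h2.comp (AddMonoidAlgebra.coeffEquiv (R := A) (M := Fin n →₀ ℤ)).injective
  refine (congrArg Function.Injective (funext fun x => ?_)).mpr h3
  induction x using AddMonoidAlgebra.induction_linear with
  | zero => simp
  | add x y hx hy => rw [map_add, hx, hy]; simp
  | single j a =>
    simp [wHomTensor_apply, TensorProduct.finsuppScalarRight_symm_apply_single]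

lemma diagHom_injective : Function.Injective (diagHom k A d Kw) := by
  rw [diagHom, diag_eq_map_comp, RingHom.coe_comp]
  exact (AddMonoidAlgebra.map_injective _ (lift_wHomTensor_injective k A Kw)).comp
    (diag_of_injective d)

variable {A}

lemma eventually_exists_exponent (u : Fin n →₀ ℤ) : ∀ᶠ N in Filter.atTop,
    ∃ v : Fin n →₀ ℕ, v.mapRange (Nat.cast : ℕ → ℤ) rfl = constExp n N + u := by
  filter_upwards [Filter.eventually_ge_atTop (∑ i, (u i).natAbs)] with N hN
  refine ⟨Finsupp.equivFunOnFinite.symm fun i => (N + u i).toNat, ?_⟩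
  ext i
  refine Int.toNat_of_nonneg ?_
  have h : (u i).natAbs ≤ ∑ i, (u i).natAbs :=
    Finset.single_le_sum (f := fun i => (u i).natAbs) (fun _ _ => Nat.zero_le _)
      (Finset.mem_univ i)
  omega

lemma eventually_single_mem_range (h : MvPolynomial (Fin n) k) (u : Fin n →₀ ℤ) (a : A) :
    ∀ᶠ N in Filter.atTop, AddMonoidAlgebra.single (constExp n N + u)
      (a ⊗ₜ[k] algebraMap (MvPolynomial (Fin n) k) Kw h) ∈ (diagHom k A d Kw).range := by
  induction h using MvPolynomial.induction_on' with
  | monomial v γ =>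
    filter_upwards [eventually_exists_exponent
      (u - scale d (v.mapRange (Nat.cast : ℕ → ℤ) rfl))] with N ⟨e, he⟩
    refine ⟨MvPolynomial.monomial e (AddMonoidAlgebra.single (v.mapRange Nat.cast rfl) (γ • a)), ?_⟩
    rw [diagHom_monomial, he, algebraMap_monomial, TensorProduct.smul_tmul, add_assoc,
      sub_add_cancel]
  | add p q hp hq =>
    filter_upwards [hp, hq] with N hp hq
    rw [map_add, TensorProduct.tmul_add, AddMonoidAlgebra.single_add]
    exact add_mem hp hq

lemma exists_denom_mul_mem_range (c : AddMonoidAlgebra (A ⊗[k] Kw) (Fin n →₀ ℤ)) :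
    ∃ f : MvPolynomial (Fin n) k, f ≠ 0 ∧ ∀ f', f ∣ f' → ∀ᶠ N in Filter.atTop,
      denom k Kw A N f' * c ∈ (diagHom k A d Kw).range := by
  have hadd : ∀ x y : AddMonoidAlgebra (A ⊗[k] Kw) (Fin n →₀ ℤ),
      (∃ f : MvPolynomial (Fin n) k, f ≠ 0 ∧ ∀ f', f ∣ f' → ∀ᶠ N in Filter.atTop,
        denom k Kw A N f' * x ∈ (diagHom k A d Kw).range) →
      (∃ f : MvPolynomial (Fin n) k, f ≠ 0 ∧ ∀ f', f ∣ f' → ∀ᶠ N in Filter.atTop,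
        denom k Kw A N f' * y ∈ (diagHom k A d Kw).range) →
      ∃ f : MvPolynomial (Fin n) k, f ≠ 0 ∧ ∀ f', f ∣ f' → ∀ᶠ N in Filter.atTop,
        denom k Kw A N f' * (x + y) ∈ (diagHom k A d Kw).range := by
    rintro x y ⟨f, hf, hx⟩ ⟨g, hg, hy⟩
    refine ⟨f * g, mul_ne_zero hf hg, fun f' h => ?_⟩
    filter_upwards [hx f' ((dvd_mul_right f g).trans h), hy f' ((dvd_mul_left g f).trans h)]
      with N hx hy
    rw [mul_add]
    exact add_mem hx hy
  have hzero : ∃ f : MvPolynomial (Fin n) k, f ≠ 0 ∧ ∀ f', f ∣ f' → ∀ᶠ N in Filter.atTop,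
      denom k Kw A N f' * 0 ∈ (diagHom k A d Kw).range :=
    ⟨1, one_ne_zero, fun f' _ => .of_forall fun N => by rw [mul_zero]; exact zero_mem _⟩
  induction c using AddMonoidAlgebra.induction_linear with
  | zero => exact hzero
  | add x y hx hy => exact hadd x y hx hy
  | single u r =>
    induction r using TensorProduct.induction_on with
    | zero => rw [AddMonoidAlgebra.single_zero]; exact hzero
    | add x y hx hy => rw [AddMonoidAlgebra.single_add]; exact hadd _ _ hx hy
    | tmul a q =>
      obtain ⟨p, f, hf, rfl⟩ := IsFractionRing.div_surjective (A := MvPolynomial (Fin n) k) q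
      have hf0 := nonZeroDivisors.ne_zero hf
      refine ⟨f, hf0, ?_⟩
      rintro _ ⟨h, rfl⟩
      filter_upwards [eventually_single_mem_range k d Kw (h * p) u a] with N hN
      have hf1 : algebraMap (MvPolynomial (Fin n) k) Kw f ≠ 0 :=
        (map_ne_zero_iff _ (IsFractionRing.injective (MvPolynomial (Fin n) k) Kw)).2 hf0
      rw [denom, AddMonoidAlgebra.single_mul_single, Algebra.TensorProduct.tmul_mul_tmul, one_mul]
      have hq : algebraMap (MvPolynomial (Fin n) k) Kw (f * h) *
          (algebraMap (MvPolynomial (Fin n) k) Kw p / algebraMap (MvPolynomial (Fin n) k) Kw f) =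
          algebraMap (MvPolynomial (Fin n) k) Kw (h * p) := by
        rw [map_mul, map_mul]
        field_simp
      rwa [hq]

lemma exists_mem_closure_el {m : ℕ} {g : SL m (AddMonoidAlgebra (A ⊗[k] Kw) (Fin n →₀ ℤ))}
    (hg : g ∈ ElemSubgroup m (AddMonoidAlgebra (A ⊗[k] Kw) (Fin n →₀ ℤ))) :
    ∃ f : MvPolynomial (Fin n) k, f ≠ 0 ∧ ∀ f', f ∣ f' → ∀ᶠ N in Filter.atTop,
      g ∈ Subgroup.closure {x | ∃ i j, ∃ h : i ≠ j, ∃ c,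
        (∃ b, diagHom k A d Kw b = denom k Kw A N f' * c) ∧ x = el i j h c} := by
  refine elem_induction (p := fun g => ∃ f : MvPolynomial (Fin n) k, f ≠ 0 ∧ ∀ f', f ∣ f' →
    ∀ᶠ N in Filter.atTop, g ∈ Subgroup.closure {x | ∃ i j, ∃ h : i ≠ j, ∃ c,
      (∃ b, diagHom k A d Kw b = denom k Kw A N f' * c) ∧ x = el i j h c}) ?_ ?_ ?_ hg
  · exact ⟨1, one_ne_zero, fun f' _ => .of_forall fun N => one_mem _⟩
  · rintro x y ⟨f, hf, hx⟩ ⟨g, hg, hy⟩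
    refine ⟨f * g, mul_ne_zero hf hg, fun f' h => ?_⟩
    filter_upwards [hx f' ((dvd_mul_right f g).trans h), hy f' ((dvd_mul_left g f).trans h)]
      with N hx hy
    exact mul_mem hx hy
  · intro i j h c
    obtain ⟨f, hf, hc⟩ := exists_denom_mul_mem_range k d Kw c
    refine ⟨f, hf, fun f' hf' => ?_⟩
    filter_upwards [hc f' hf'] with N hN
    exact Subgroup.subset_closure ⟨i, j, h, c, hN, rfl⟩

variable {d}

/-- For large `N`, `t₁^N ⋯ tₙ^N f(w)` is the image of a polynomial in `t` whose coefficients are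
units. -/
lemma eventually_denom_eq (hd : ∀ i, 0 < d i) (f : MvPolynomial (Fin n) k) :
    ∀ᶠ N in Filter.atTop, ∃ e : (Fin n →₀ ℕ) → Fin n →₀ ℕ, Set.InjOn e f.support ∧
      diagHom k A d Kw (∑ v ∈ f.support, MvPolynomial.monomial (e v)
        (AddMonoidAlgebra.single (v.mapRange (Nat.cast : ℕ → ℤ) rfl)
          (algebraMap k A (f.coeff v)))) = denom k Kw A N f := by
  have h := (Filter.eventually_all_finset f.support).2 fun v _ => eventually_exists_exponent
    (-scale d (v.mapRange (Nat.cast : ℕ → ℤ) rfl))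
  filter_upwards [h] with N hN
  choose! e he using hN
  refine ⟨e, fun v hv w hw hvw => ?_, ?_⟩
  · have h1 := he v hv
    rw [hvw, he w hw, add_right_inj, neg_inj] at h1
    ext i
    have h2 := DFunLike.congr_fun h1 i
    simp only [scale_apply, Finsupp.mapRange_apply] at h2
    have h3 : (d i : ℤ) ≠ 0 := by exact_mod_cast (hd i).ne'
    exact_mod_cast (mul_left_cancel₀ h3 h2).symm
  · rw [map_sum]
    conv_rhs => rw [denom, f.as_sum, map_sum, TensorProduct.tmul_sum,
      ← AddMonoidAlgebra.singleAddHom_apply, map_sum]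
    refine Finset.sum_congr rfl fun v hv => ?_
    rw [diagHom_monomial, he v hv, neg_add_cancel_right, algebraMap_monomial,
      Algebra.algebraMap_eq_smul_one, TensorProduct.smul_tmul]
    rfl

theorem mem_of_map_diagHom_mem (hd : ∀ i, 0 < d i) {m : ℕ} (hm : 3 ≤ m)
    (g : SL m (MvPolynomial (Fin n) (AddMonoidAlgebra A (Fin n →₀ ℤ))))
    (hg : mp (diagHom k A d Kw) g ∈ ElemSubgroup m _) : g ∈ ElemSubgroup m _ := by
  obtain ⟨f, hf, hcl⟩ := exists_mem_closure_el k d Kw hg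
  obtain ⟨N, hN, e, he, hs⟩ := ((hcl f dvd_rfl).and
    (eventually_denom_eq (A := A) k Kw hd f)).exists
  refine mem_of_map_away_sum_mem hm (MvPolynomial.support_nonempty.2 hf) (fun v hv => ?_) he _ rfl
    g (map_away_mem_of_injective (diagHom_injective k A d Kw) ?_ (by rwa [hs]))
  · have h1 : IsUnit (algebraMap k A (f.coeff v)) :=
      (IsUnit.mk0 _ (MvPolynomial.mem_support_iff.1 hv)).map _
    obtain ⟨b, hb⟩ := h1.exists_right_inv
    refine IsUnit.of_mul_eq_one (AddMonoidAlgebra.single (-v.mapRange (Nat.cast : ℕ → ℤ) rfl) b) ?_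
    rw [AddMonoidAlgebra.single_mul_single, hb, add_neg_cancel]
    rfl
  · rw [hs]
    exact isUnit_denom k A Kw N hf

end FunctionField

end Substitution

end SLElem

/-- Lemma 4.2 of the paper, for `SL_m` (`m ≥ 3`): let
`B = A[z₁^{±1},…,zₙ^{±1}, t₁,…,tₙ]` and `C = A ⊗_k k(w₁,…,wₙ)[t₁^{±1},…,tₙ^{±1}]`,
and let `φ : B → C` be the homomorphism fixing `A`, sending `tᵢ ↦ tᵢ` and
`zᵢ ↦ wᵢ·tᵢ^{dᵢ}` with `dᵢ > 0`.  If `g ∈ SL_m(B)` has `φ(g) ∈ E_m(C)`, then `g ∈ E_m(B)`. -/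
theorem k1_diagonal_substitution_injective
    (k : Type*) [Field k] (A : Type*) [CommRing A] [Algebra k A]
    (m : ℕ) (hm : 3 ≤ m) (n : ℕ) (d : Fin n → ℕ) (hd : ∀ i, 0 < d i)
    -- `Kw` is (a model of) the rational function field `k(w₁,…,wₙ)`
    (Kw : Type*) [Field Kw] [Algebra (MvPolynomial (Fin n) k) Kw]
    [IsFractionRing (MvPolynomial (Fin n) k) Kw]
    [Algebra k Kw] [IsScalarTower k (MvPolynomial (Fin n) k) Kw]
    -- `φ : B → C`
    (φ : MvPolynomial (Fin n) (AddMonoidAlgebra A (Fin n →₀ ℤ)) →+*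
      AddMonoidAlgebra (A ⊗[k] Kw) (Fin n →₀ ℤ))
    -- `φ` is the identity on `A`
    (hφA : ∀ a : A,
      φ (MvPolynomial.C (AddMonoidAlgebra.single 0 a))
        = AddMonoidAlgebra.single 0 (a ⊗ₜ[k] 1))
    -- `φ` sends `tᵢ` to `tᵢ`
    (hφt : ∀ i : Fin n,
      φ (MvPolynomial.X i)
        = AddMonoidAlgebra.single (Finsupp.single i (1 : ℤ)) 1)
    -- `φ` sends `zᵢ` to `wᵢ·tᵢ^{dᵢ}`
    (hφz : ∀ i : Fin n,
      φ (MvPolynomial.C (AddMonoidAlgebra.single (Finsupp.single i (1 : ℤ)) (1 : A)))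
        = AddMonoidAlgebra.single (Finsupp.single i (d i : ℤ))
            ((1 : A) ⊗ₜ[k] algebraMap (MvPolynomial (Fin n) k) Kw (MvPolynomial.X i)))
    (g : SpecialLinearGroup (Fin m) (MvPolynomial (Fin n) (AddMonoidAlgebra A (Fin n →₀ ℤ))))
    (h : SpecialLinearGroup.map φ g
        ∈ ElemSubgroup m (AddMonoidAlgebra (A ⊗[k] Kw) (Fin n →₀ ℤ))) :
    g ∈ ElemSubgroup m (MvPolynomial (Fin n) (AddMonoidAlgebra A (Fin n →₀ ℤ))) := by
  have hφ : φ = SLElem.diagHom k A d Kw := by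
    refine SLElem.laurent_mvPolynomial_ext (fun a => ?_) (fun i => ?_) fun i => ?_
    · rw [hφA, SLElem.diagHom, SLElem.diag_C_single]
      simp
    · rw [hφz, SLElem.diagHom, SLElem.diag_C_single, SLElem.scale_single, mul_one,
        SLElem.wHomTensor_apply, SLElem.wHom_single]
      simp
    · rw [hφt, SLElem.diagHom, SLElem.diag_X]
  subst hφ
  exact SLElem.mem_of_map_diagHom_mem k Kw hd hm g h
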